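/- arXiv:2102.01654 — 2 statements merged into one kernel-verified Lean document; each statement's English description precedes it below -/
import Mathlib

section
/- For every ℓ > 0 and Lebesgue-almost every pair (α, θ) with 0 < α < θ < π/2 and tan θ > 2ℓ + tan α, the rotation number ρ(F_{ℓ,α,θ}) can be written as p/q with p, q coprime nonnegative integers and q ODD. -/
open Real Filter Set

/-- Rotation number of a lift `T` of a circle homeomorphism,
defined as the limit of `T^[n] 0 / n` (which exists and is independent
of the base point for lifts of orientation-preserving circle homeos). -/
noncomputable def rotationNumber (T : ℝ → ℝ) : ℝ :=
  limUnder atTop (fun n : ℕ => T^[n] 0 / (n : ℝ))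

/-- The expansion factor `Λ = sin(θ+α)/sin(θ−α)`. -/
noncomputable def Lam (α θ : ℝ) : ℝ := Real.sin (θ + α) / Real.sin (θ - α)

/-- The break point of increase `a₀ = (tan θ − 2ℓ)/(2 tan θ)`. -/
noncomputable def brk0 (ℓ θ : ℝ) : ℝ := (Real.tan θ - 2 * ℓ) / (2 * Real.tan θ)

/-- The break point of decrease `a₁ = −(2ℓ + tan α)/(2 tan θ)`. -/
noncomputable def brk1 (ℓ α θ : ℝ) : ℝ := -(2 * ℓ + Real.tan α) / (2 * Real.tan θ)

/-- The two-piece definition of the lift on the fundamental interval `[a₁, a₁+1)`. -/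
noncomputable def Ftrap0 (ℓ α θ x : ℝ) : ℝ :=
  if x ≤ brk0 ℓ θ then -brk1 ℓ α θ + (Lam α θ)⁻¹ * (x - brk1 ℓ α θ)
  else 1 - brk0 ℓ θ + Lam α θ * (x - brk0 ℓ θ)

/-- The lift `F_{ℓ,α,θ} : ℝ → ℝ` of the Poincaré map of the internal-wave
billiard in a rectangular trapezoid: it is given by the two-piece formula on
`[a₁, a₁+1)` and extended by `F(x+k) = F(x)+k` for `k ∈ ℤ`. -/
noncomputable def Ftrap (ℓ α θ x : ℝ) : ℝ :=
  Ftrap0 ℓ α θ (x - ⌊x - brk1 ℓ α θ⌋) + ⌊x - brk1 ℓ α θ⌋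

/-- The break points of the normalized lift `baseLift r`. -/
noncomputable def bpt (r : ℝ) (k : ℤ) : ℝ := k / 2 - if Even k then r / 2 else 0

/-- The slope of `baseLift r` between `bpt r k` and `bpt r (k + 1)`. -/
noncomputable def pieceSlope (r : ℝ) (k : ℤ) : ℝ :=
  if Even k then (1 - r) / (1 + r) else (1 + r) / (1 - r)

/-- The lift of the trapezoid map after translating the break point of increase to `1 / 2` and
removing the additive parameter. -/
noncomputable def baseLift (r x : ℝ) : ℝ :=
  (if x - ⌊x + r / 2⌋ ≤ 1 / 2 then r / 2 + (1 - r) / (1 + r) * (x - ⌊x + r / 2⌋ + r / 2)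
    else 1 / 2 + (1 + r) / (1 - r) * (x - ⌊x + r / 2⌋ - 1 / 2)) + ⌊x + r / 2⌋

lemma bpt_even (r : ℝ) (j : ℤ) : bpt r (2 * j) = j - r / 2 := by
  simp [bpt]

lemma bpt_odd (r : ℝ) (j : ℤ) : bpt r (2 * j + 1) = j + 1 / 2 := by
  have : ¬ Even (2 * j + 1) := by simp
  rw [bpt, if_neg this]; push_cast; ring

lemma bpt_add_two_mul (r : ℝ) (k j : ℤ) : bpt r (k + 2 * j) = bpt r k + j := by
  simp [bpt, Int.even_add]; ring

lemma bpt_neg (r : ℝ) (k : ℤ) : bpt r (-k) = bpt r k - k := by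
  simp [bpt]; ring

lemma baseLift_add_one (r x : ℝ) : baseLift r (x + 1) = baseLift r x + 1 := by
  have : ⌊x + 1 + r / 2⌋ = ⌊x + r / 2⌋ + 1 := by
    rw [add_right_comm, Int.floor_add_one]
  simp only [baseLift, this]
  push_cast
  simp only [add_sub_add_right_eq_sub, ← add_assoc]

lemma measurable_baseLift : Measurable fun z : ℝ × ℝ => baseLift z.1 z.2 := by
  have hf : Measurable fun z : ℝ × ℝ => ((⌊z.2 + z.1 / 2⌋ : ℤ) : ℝ) :=
    measurable_from_top.comp (Int.measurable_floor.comp (by fun_prop))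
  unfold baseLift
  refine Measurable.add (Measurable.ite ?_ ?_ ?_) hf
  · exact measurableSet_le (by fun_prop) (by fun_prop)
  · fun_prop
  · fun_prop

local notation "ρ" => CircleDeg1Lift.translationNumber

section Base

variable (r : Ioo (0 : ℝ) 1)

/-- The expansion factor of `baseLift r`. -/
noncomputable def expansion : ℝ := (1 + (r : ℝ)) / (1 - r)

lemma one_lt_expansion : 1 < expansion r := by
  have h0 := r.2.1
  have h1 := r.2.2
  rw [expansion, lt_div_iff₀ (by linarith)]; linarith

lemma expansion_pos : 0 < expansion r := one_pos.trans (one_lt_expansion r)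

lemma inv_expansion_lt_one : (expansion r)⁻¹ < 1 := inv_lt_one_of_one_lt₀ (one_lt_expansion r)

lemma pieceSlope_of_even {k : ℤ} (hk : Even k) : pieceSlope r k = (expansion r)⁻¹ := by
  rw [pieceSlope, if_pos hk, expansion, inv_div]

lemma pieceSlope_of_odd {k : ℤ} (hk : Odd k) : pieceSlope r k = expansion r := by
  rw [pieceSlope, if_neg (Int.not_even_iff_odd.2 hk), expansion]

lemma pieceSlope_pos (k : ℤ) : 0 < pieceSlope r k := by
  have := expansion_pos r
  rcases Int.even_or_odd k with hk | hk
  · rw [pieceSlope_of_even r hk]; positivity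
  · rwa [pieceSlope_of_odd r hk]

lemma inv_expansion_le_pieceSlope (k : ℤ) : (expansion r)⁻¹ ≤ pieceSlope r k := by
  rcases Int.even_or_odd k with hk | hk
  · rw [pieceSlope_of_even r hk]
  · rw [pieceSlope_of_odd r hk]
    exact ((inv_expansion_lt_one r).trans (one_lt_expansion r)).le

lemma pieceSlope_le_expansion (k : ℤ) : pieceSlope r k ≤ expansion r := by
  rcases Int.even_or_odd k with hk | hk
  · rw [pieceSlope_of_even r hk]
    exact ((inv_expansion_lt_one r).trans (one_lt_expansion r)).le
  · rw [pieceSlope_of_odd r hk]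

lemma pieceSlope_mul_of_odd_add {k l : ℤ} (h : Odd (k + l)) :
    pieceSlope r k * pieceSlope r l = 1 := by
  have := (expansion_pos r).ne'
  rcases Int.even_or_odd k with hk | hk
  · have hl : Odd l := by
      rcases Int.even_or_odd l with hl | hl
      · exact absurd h (Int.not_odd_iff_even.2 (hk.add hl))
      · exact hl
    rw [pieceSlope_of_even r hk, pieceSlope_of_odd r hl, inv_mul_cancel₀ this]
  · have hl : Even l := by
      rcases Int.even_or_odd l with hl | hl
      · exact hl
      · exact absurd h (Int.not_odd_iff_even.2 (hk.add_odd hl))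
    rw [pieceSlope_of_odd r hk, pieceSlope_of_even r hl, mul_inv_cancel₀ this]

lemma bpt_lt_succ (k : ℤ) : bpt r k < bpt r (k + 1) := by
  have h0 := r.2.1
  have h1 := r.2.2
  rcases Int.even_or_odd' k with ⟨j, rfl | rfl⟩
  · rw [bpt_even, bpt_odd]; linarith
  · rw [bpt_odd, show 2 * j + 1 + 1 = 2 * (j + 1) by ring, bpt_even]; push_cast; linarith

lemma bpt_strictMono : StrictMono (bpt r) := strictMono_int_of_lt_succ (bpt_lt_succ r)

lemma exists_mem_piece (x : ℝ) : ∃ k : ℤ, x ∈ Icc (bpt r k) (bpt r (k + 1)) := by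
  set n := ⌊x + r / 2⌋
  have h0 : (n : ℝ) ≤ x + r / 2 := Int.floor_le _
  have h1 : x + r / 2 < n + 1 := Int.lt_floor_add_one _
  rcases le_total x (n + 1 / 2) with h | h
  · exact ⟨2 * n, by rw [bpt_even]; linarith, by rw [bpt_odd]; exact h⟩
  · refine ⟨2 * n + 1, by rw [bpt_odd]; exact h, ?_⟩
    rw [show 2 * n + 1 + 1 = 2 * (n + 1) by ring, bpt_even]; push_cast; linarith

lemma baseLift_of_mem_piece {k : ℤ} {x : ℝ} (hx : x ∈ Icc (bpt r k) (bpt r (k + 1))) :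
    baseLift r x = -bpt r (-k) + pieceSlope r k * (x - bpt r k) := by
  have h0 := r.2.1
  have h1 := r.2.2
  have e1 : (1 - (r : ℝ)) ≠ 0 := by linarith
  have e2 : (1 + (r : ℝ)) ≠ 0 := by linarith
  rcases Int.even_or_odd' k with ⟨j, rfl | rfl⟩
  · rw [bpt_even, bpt_odd] at hx
    have hfl : ⌊x + r / 2⌋ = j := by
      rw [Int.floor_eq_iff]
      constructor <;> linarith [hx.1, hx.2]
    rw [baseLift, hfl, if_pos (by linarith [hx.2]), pieceSlope, if_pos (by simp), bpt_neg, bpt_even]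
    push_cast
    ring
  · rw [bpt_odd, show 2 * j + 1 + 1 = 2 * (j + 1) by ring, bpt_even] at hx
    push_cast at hx
    rw [pieceSlope, if_neg (by simp), bpt_neg, bpt_odd]
    rcases hx.2.lt_or_eq with hlt | heq
    · have hfl : ⌊x + r / 2⌋ = j := by
        rw [Int.floor_eq_iff]
        constructor <;> linarith [hx.1, hx.2]
      rw [baseLift, hfl]
      push_cast
      rcases hx.1.eq_or_lt with h | h
      · rw [if_pos (by linarith), ← h]
        field_simp
        ring
      · rw [if_neg (by linarith)]
        ring
    · have hfl : ⌊x + r / 2⌋ = j + 1 := by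
        rw [Int.floor_eq_iff]
        push_cast
        constructor <;> linarith [hx.1, hx.2]
      rw [baseLift, hfl, heq]
      push_cast
      rw [if_pos (by linarith)]
      field_simp
      ring

lemma baseLift_bpt (k : ℤ) : baseLift r (bpt r k) = -bpt r (-k) := by
  rw [baseLift_of_mem_piece r (left_mem_Icc.2 (bpt_lt_succ r k).le)]; ring

lemma baseLift_sub_of_mem_piece {k : ℤ} {x y : ℝ} (hx : x ∈ Icc (bpt r k) (bpt r (k + 1)))
    (hy : y ∈ Icc (bpt r k) (bpt r (k + 1))) :
    baseLift r y - baseLift r x = pieceSlope r k * (y - x) := by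
  rw [baseLift_of_mem_piece r hx, baseLift_of_mem_piece r hy]; ring

lemma monotone_of_monotoneOn_pieces {f : ℝ → ℝ}
    (hf : ∀ k : ℤ, MonotoneOn f (Icc (bpt r k) (bpt r (k + 1)))) : Monotone f := by
  have key : ∀ n : ℕ, ∀ k : ℤ, ∀ x ∈ Icc (bpt r k) (bpt r (k + 1)),
      ∀ y ∈ Icc (bpt r (k + n)) (bpt r (k + n + 1)), x ≤ y → f x ≤ f y := by
    intro n
    induction n with
    | zero => intro k x hx y hy hxy; exact hf k hx (by simpa using hy) hxy
    | succ n ih =>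
      intro k x hx y hy _
      have hk := (bpt_lt_succ r k).le
      have hk' : bpt r (k + 1) ≤ y :=
        ((bpt_strictMono r).monotone (by push_cast; omega)).trans hy.1
      refine (hf k hx (right_mem_Icc.2 hk) hx.2).trans (ih (k + 1) _
        (left_mem_Icc.2 (bpt_lt_succ r _).le) y ?_ hk')
      push_cast at hy
      rwa [add_assoc k, add_comm (1 : ℤ)]
  intro x y hxy
  obtain ⟨k, hk⟩ := exists_mem_piece r x
  obtain ⟨l, hl⟩ := exists_mem_piece r y
  rcases le_or_gt k l with h | h
  · refine key (l - k).toNat k x hk y ?_ hxy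
    rwa [Int.toNat_of_nonneg (by omega), add_sub_cancel]
  · have : bpt r (l + 1) ≤ bpt r k := (bpt_strictMono r).monotone (by omega)
    rw [le_antisymm hxy (hl.2.trans (this.trans hk.1))]

lemma inv_expansion_mul_le_baseLift_sub {x y : ℝ} (h : x ≤ y) :
    (expansion r)⁻¹ * (y - x) ≤ baseLift r y - baseLift r x := by
  have hm : Monotone fun x => baseLift r x - (expansion r)⁻¹ * x := by
    refine monotone_of_monotoneOn_pieces r fun k x hx y hy hxy => ?_
    have := mul_le_mul_of_nonneg_right (inv_expansion_le_pieceSlope r k) (sub_nonneg.2 hxy)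
    have := baseLift_sub_of_mem_piece r hx hy
    linarith
  have := hm h
  simp only at this
  linarith

lemma baseLift_sub_le_expansion_mul {x y : ℝ} (h : x ≤ y) :
    baseLift r y - baseLift r x ≤ expansion r * (y - x) := by
  have hm : Monotone fun x => expansion r * x - baseLift r x := by
    refine monotone_of_monotoneOn_pieces r fun k x hx y hy hxy => ?_
    have := mul_le_mul_of_nonneg_right (pieceSlope_le_expansion r k) (sub_nonneg.2 hxy)
    have := baseLift_sub_of_mem_piece r hx hy
    linarith
  have := hm h
  simp only at this
  linarith

lemma baseLift_strictMono : StrictMono (baseLift r) := fun x y h => by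
  have := inv_expansion_mul_le_baseLift_sub r h.le
  have := mul_pos (inv_pos.2 (expansion_pos r)) (sub_pos.2 h)
  linarith

lemma continuous_baseLift : Continuous (baseLift r) := by
  have : LipschitzWith (expansion r).toNNReal (baseLift r) := by
    refine LipschitzWith.of_le_add_mul _ fun x y => ?_
    rw [Real.coe_toNNReal _ (expansion_pos r).le]
    rcases le_total x y with h | h
    · have := (baseLift_strictMono r).monotone h
      have := mul_nonneg (expansion_pos r).le (dist_nonneg (x := x) (y := y))
      linarith
    · rw [Real.dist_eq, abs_of_nonneg (sub_nonneg.2 h)]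
      linarith [baseLift_sub_le_expansion_mul r h]
  exact this.continuous

lemma baseLift_neg_baseLift (x : ℝ) : baseLift r (-baseLift r x) = -x := by
  obtain ⟨k, hk⟩ := exists_mem_piece r x
  have hmono := (baseLift_strictMono r).monotone
  have h1 := hmono hk.1
  have h2 := hmono hk.2
  rw [baseLift_bpt] at h1 h2
  have hmem : -baseLift r x ∈ Icc (bpt r (-(k + 1))) (bpt r (-(k + 1) + 1)) := by
    rw [show -(k + 1) + 1 = -k by ring]
    constructor <;> linarith
  have hs : pieceSlope r (-(k + 1)) * pieceSlope r k = 1 :=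
    pieceSlope_mul_of_odd_add r ⟨-1, by ring⟩
  have hx := baseLift_sub_of_mem_piece r hk (right_mem_Icc.2 (bpt_lt_succ r k).le)
  rw [baseLift_of_mem_piece r hmem, neg_neg]
  rw [baseLift_bpt] at hx
  linear_combination pieceSlope r (-(k + 1)) * hx + (bpt r (k + 1) - x) * hs

/-- The lift of the trapezoid map with parameters `r` and `t`, in the normalized coordinate. -/
noncomputable def trapLift (t : ℝ) : CircleDeg1Lift where
  toFun x := baseLift r x + t
  monotone' _ _ h := add_le_add_left ((baseLift_strictMono r).monotone h) t
  map_add_one' x := by rw [baseLift_add_one, add_right_comm]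

lemma trapLift_apply (t x : ℝ) : trapLift r t x = baseLift r x + t := rfl

lemma continuous_trapLift (t : ℝ) : Continuous (trapLift r t) :=
  (continuous_baseLift r).add continuous_const

lemma trapLift_strictMono (t : ℝ) : StrictMono (trapLift r t) := fun _ _ h =>
  add_lt_add_left (baseLift_strictMono r h) t

lemma trapLift_mono {t t' : ℝ} (h : t ≤ t') : trapLift r t ≤ trapLift r t' := fun x =>
  add_le_add_right h (baseLift r x)

lemma iterate_add_int (f : CircleDeg1Lift) (n : ℕ) (x : ℝ) (k : ℤ) :
    f^[n] (x + k) = f^[n] x + k := by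
  rw [← CircleDeg1Lift.coe_pow, CircleDeg1Lift.map_add_int]

lemma iterate_sub_int (f : CircleDeg1Lift) (n : ℕ) (x : ℝ) (k : ℤ) :
    f^[n] (x - k) = f^[n] x - k := by
  rw [← CircleDeg1Lift.coe_pow, CircleDeg1Lift.map_sub_int]

lemma iterate_le_iterate_of_le {t t' : ℝ} (h : t ≤ t') (n : ℕ) (x : ℝ) :
    (trapLift r t)^[n] x ≤ (trapLift r t')^[n] x :=
  CircleDeg1Lift.iterate_mono (trapLift_mono r h) n x

lemma iterate_neg_baseLift_iterate (t : ℝ) (n : ℕ) (x : ℝ) :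
    (trapLift r t)^[n] (-baseLift r ((trapLift r t)^[n] x)) = -baseLift r x := by
  induction n with
  | zero => rfl
  | succ n ih =>
    rw [Function.iterate_succ_apply, Function.iterate_succ_apply' _ n x, trapLift_apply r t
      (-baseLift r _), baseLift_neg_baseLift, trapLift_apply, neg_add, neg_add_cancel_right, ih]

lemma translationNumber_iterate_two (f : CircleDeg1Lift) (n : ℕ) :
    ρ (f ^ (n + n)) = 2 * n * ρ f := by
  rw [CircleDeg1Lift.translationNumber_pow]; push_cast; ring

lemma rotation_le_of_iterate_bpt_le {t : ℝ} {n : ℕ} {l k : ℤ}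
    (h : (trapLift r t)^[n] (bpt r l) ≤ bpt r (l + k)) : 2 * n * ρ (trapLift r t) ≤ k := by
  have hmono := (trapLift r t).monotone.iterate n
  have h1 := hmono (neg_le_neg ((baseLift_strictMono r).monotone h))
  rw [iterate_neg_baseLift_iterate, baseLift_bpt, baseLift_bpt, neg_neg, neg_neg, bpt_neg, bpt_neg,
    iterate_sub_int] at h1
  push_cast at h1
  have h2 : (trapLift r t ^ (n + n)) (bpt r l) ≤ bpt r l + k := by
    rw [CircleDeg1Lift.coe_pow, Function.iterate_add_apply]
    have := hmono h
    linarith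
  rw [← translationNumber_iterate_two]
  exact CircleDeg1Lift.translationNumber_le_of_le_add_int _ h2

lemma le_rotation_of_le_iterate_bpt {t : ℝ} {n : ℕ} {l k : ℤ}
    (h : bpt r (l + k) ≤ (trapLift r t)^[n] (bpt r l)) : k ≤ 2 * n * ρ (trapLift r t) := by
  have hmono := (trapLift r t).monotone.iterate n
  have h1 := hmono (neg_le_neg ((baseLift_strictMono r).monotone h))
  rw [iterate_neg_baseLift_iterate, baseLift_bpt, baseLift_bpt, neg_neg, neg_neg, bpt_neg, bpt_neg,
    iterate_sub_int] at h1
  push_cast at h1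
  have h2 : bpt r l + k ≤ (trapLift r t ^ (n + n)) (bpt r l) := by
    rw [CircleDeg1Lift.coe_pow, Function.iterate_add_apply]
    have := hmono h
    linarith
  rw [← translationNumber_iterate_two]
  exact CircleDeg1Lift.le_translationNumber_of_add_int_le _ h2

lemma iterate_bpt_lt {t : ℝ} {n : ℕ} {k : ℤ} (l : ℤ) (h : 2 * n * ρ (trapLift r t) < k) :
    (trapLift r t)^[n] (bpt r l) < bpt r (l + k) :=
  lt_of_not_ge fun h' => (le_rotation_of_le_iterate_bpt r h').not_gt h

lemma lt_iterate_bpt {t : ℝ} {n : ℕ} {k : ℤ} (l : ℤ) (h : k < 2 * n * ρ (trapLift r t)) :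
    bpt r (l + k) < (trapLift r t)^[n] (bpt r l) :=
  lt_of_not_ge fun h' => (rotation_le_of_iterate_bpt_le r h').not_gt h

lemma iterate_lt_iterate_of_lt {t t' : ℝ} (h : t < t') {n : ℕ} (hn : 0 < n) (x : ℝ) :
    (trapLift r t)^[n] x < (trapLift r t')^[n] x := by
  obtain ⟨n, rfl⟩ := Nat.exists_eq_add_of_lt hn
  rw [zero_add, Function.iterate_succ_apply', Function.iterate_succ_apply', trapLift_apply,
    trapLift_apply]
  have := (baseLift_strictMono r).monotone (iterate_le_iterate_of_le r h.le n x)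
  linarith

lemma continuous_iterate_param (n : ℕ) (x : ℝ) : Continuous fun t => (trapLift r t)^[n] x := by
  induction n with
  | zero => exact continuous_const
  | succ n ih =>
    simp only [Function.iterate_succ_apply', trapLift_apply]
    exact ((continuous_baseLift r).comp ih).add continuous_id

lemma iterate_intCast_param (n : ℕ) (k : ℤ) (x : ℝ) :
    (trapLift r k)^[n] x = (trapLift r 0)^[n] x + n * k := by
  induction n with
  | zero => simp
  | succ n ih =>
    have h := (trapLift r 0).map_add_int ((trapLift r 0)^[n] x) (n * k)
    rw [Function.iterate_succ_apply', Function.iterate_succ_apply', ih, trapLift_apply]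
    rw [trapLift_apply] at h
    push_cast at h ⊢
    linarith

lemma exists_iterate_eq_add_int {q : ℕ} (hq : 0 < q) (p : ℤ) (x : ℝ) :
    ∃ t, (trapLift r t)^[q] x = x + p := by
  have hq1 : (1 : ℝ) ≤ q := by exact_mod_cast hq
  have h := (continuous_iterate_param r q x)
  set D := x + p - (trapLift r 0)^[q] x with hD
  have hlow : (trapLift r ((-⌈|D|⌉ : ℤ) : ℝ))^[q] x ≤ x + p := by
    rw [iterate_intCast_param]
    have h1 : |D| ≤ ⌈|D|⌉ := Int.le_ceil _
    have h2 := neg_abs_le D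
    push_cast
    nlinarith [abs_nonneg D]
  have hhigh : x + p ≤ (trapLift r ((⌈|D|⌉ : ℤ) : ℝ))^[q] x := by
    rw [iterate_intCast_param]
    have h1 : |D| ≤ ⌈|D|⌉ := Int.le_ceil _
    have h2 := le_abs_self D
    nlinarith [abs_nonneg D]
  exact mem_range_of_exists_le_of_exists_ge h ⟨_, hlow⟩ ⟨_, hhigh⟩

lemma rotation_eq_of_iterate_eq {t x : ℝ} {q : ℕ} {p : ℤ} (hq : 0 < q)
    (h : (trapLift r t)^[q] x = x + p) : ρ (trapLift r t) = p / q := by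
  rw [← CircleDeg1Lift.coe_pow] at h
  exact CircleDeg1Lift.translationNumber_of_map_pow_eq_add_int _ h hq

lemma iterate_bpt_lt_of_rotation_eq {t : ℝ} {q : ℕ} {p : ℤ} (hq : 0 < q)
    (hρ : ρ (trapLift r t) = p / q) {n : ℕ} {k : ℤ} (l : ℤ) (h : n * (2 * p) < k * q) :
    (trapLift r t)^[n] (bpt r l) < bpt r (l + k) := by
  refine iterate_bpt_lt r l ?_
  have h' : (n : ℝ) * (2 * p) < k * q := by exact_mod_cast h
  have hq' : (0 : ℝ) < q := by exact_mod_cast hq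
  rw [hρ, ← mul_div_assoc, div_lt_iff₀ hq']
  linarith

lemma lt_iterate_bpt_of_rotation_eq {t : ℝ} {q : ℕ} {p : ℤ} (hq : 0 < q)
    (hρ : ρ (trapLift r t) = p / q) {n : ℕ} {k : ℤ} (l : ℤ) (h : k * q < n * (2 * p)) :
    bpt r (l + k) < (trapLift r t)^[n] (bpt r l) := by
  refine lt_iterate_bpt r l ?_
  have h' : (k : ℝ) * q < n * (2 * p) := by exact_mod_cast h
  have hq' : (0 : ℝ) < q := by exact_mod_cast hq
  rw [hρ, ← mul_div_assoc, lt_div_iff₀ hq']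
  linarith

lemma exists_iterate_sub_eq_mul (κ : ℕ → ℤ) (x : ℝ) (n : ℕ) :
    ∃ C : ℝ, 0 < C ∧ ∀ t t' : ℝ,
      (∀ i ∈ Finset.Ico 1 (n + 1),
        (trapLift r t)^[i] x ∈ Icc (bpt r (κ i)) (bpt r (κ i + 1))) →
      (∀ i ∈ Finset.Ico 1 (n + 1),
        (trapLift r t')^[i] x ∈ Icc (bpt r (κ i)) (bpt r (κ i + 1))) →
      (trapLift r t')^[n + 1] x - (trapLift r t)^[n + 1] x = C * (t' - t) := by
  induction n with
  | zero => exact ⟨1, one_pos, fun t t' _ _ => by simp [trapLift_apply]⟩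
  | succ n ih =>
    obtain ⟨C, hC, h⟩ := ih
    refine ⟨pieceSlope r (κ (n + 1)) * C + 1,
      by have := mul_pos (pieceSlope_pos r (κ (n + 1))) hC; linarith, fun t t' ht ht' => ?_⟩
    have hsub : Finset.Ico 1 (n + 1) ⊆ Finset.Ico 1 (n + 1 + 1) :=
      Finset.Ico_subset_Ico_right (by omega)
    have hn : n + 1 ∈ Finset.Ico 1 (n + 1 + 1) := by simp
    have h1 := h t t' (fun i hi => ht i (hsub hi)) (fun i hi => ht' i (hsub hi))
    have h2 := baseLift_sub_of_mem_piece r (ht _ hn) (ht' _ hn)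
    rw [Function.iterate_succ_apply' _ (n + 1), Function.iterate_succ_apply' _ (n + 1),
      trapLift_apply, trapLift_apply]
    linear_combination h2 + pieceSlope r (κ (n + 1)) * h1

lemma iterate_sub_eq_prod_mul (κ : ℕ → ℤ) {t x y : ℝ} (n : ℕ)
    (hx : ∀ i ∈ Finset.Ico 1 (n + 1),
      (trapLift r t)^[i] x ∈ Icc (bpt r (κ i)) (bpt r (κ i + 1)))
    (hy : ∀ i ∈ Finset.Ico 1 (n + 1),
      (trapLift r t)^[i] y ∈ Icc (bpt r (κ i)) (bpt r (κ i + 1))) :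
    (trapLift r t)^[n + 1] y - (trapLift r t)^[n + 1] x =
      (∏ i ∈ Finset.Ico 1 (n + 1), pieceSlope r (κ i)) * (baseLift r y - baseLift r x) := by
  induction n with
  | zero => simp [trapLift_apply]
  | succ n ih =>
    have hsub : Finset.Ico 1 (n + 1) ⊆ Finset.Ico 1 (n + 1 + 1) :=
      Finset.Ico_subset_Ico_right (by omega)
    have hn : n + 1 ∈ Finset.Ico 1 (n + 1 + 1) := by simp
    have h1 := ih (fun i hi => hx i (hsub hi)) (fun i hi => hy i (hsub hi))
    have h2 := baseLift_sub_of_mem_piece r (hx _ hn) (hy _ hn)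
    rw [Function.iterate_succ_apply' _ (n + 1), Function.iterate_succ_apply' _ (n + 1),
      trapLift_apply, trapLift_apply, Finset.prod_Ico_succ_top (by omega)]
    linear_combination h2 + pieceSlope r (κ (n + 1)) * h1

lemma prod_pieceSlope_eq_one (κ : ℕ → ℤ) (q : ℕ)
    (h : ∀ i ∈ Finset.Ico 1 q, Odd (κ i + κ (q - i))) :
    ∏ i ∈ Finset.Ico 1 q, pieceSlope r (κ i) = 1 := by
  set P := ∏ i ∈ Finset.Ico 1 q, pieceSlope r (κ i) with hP
  have hpos : 0 < P := Finset.prod_pos fun i _ => pieceSlope_pos r _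
  have hrefl : ∏ i ∈ Finset.Ico 1 q, pieceSlope r (κ (q - i)) = P := by
    refine Finset.prod_nbij' (fun i => q - i) (fun i => q - i) ?_ ?_ ?_ ?_ ?_ <;>
      simp only [Finset.mem_Ico] <;> intros <;> first | omega | trivial
  have hsq : P * P = 1 := by
    nth_rewrite 2 [← hrefl]
    rw [hP, ← Finset.prod_mul_distrib]
    exact Finset.prod_eq_one fun i hi => pieceSlope_mul_of_odd_add r (h i hi)
  nlinarith

/-- The arithmetic data attached to a rotation number `p / q` in lowest terms with `q` odd: the
residue `m` with `m * (2 * p) ≡ -1` modulo `q`. -/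
structure IsTongueData (q m : ℕ) (p j : ℤ) : Prop where
  pos : 0 < q
  lt : m < q
  mul_eq : m * (2 * p) = (2 * j + 1) * q - 1
  dvd : ∀ i : ℤ, (q : ℤ) ∣ i * (2 * p) → (q : ℤ) ∣ i

lemma exists_isTongueData {q : ℕ} {p : ℤ} (hq : Odd q) (hpq : IsCoprime p q) :
    ∃ m j, IsTongueData q m p j := by
  have hq0 : 0 < q := hq.pos
  obtain ⟨a, ha⟩ := hq
  have h2 : IsCoprime (2 : ℤ) q := ⟨-a, 1, by rw [ha]; push_cast; ring⟩
  have hcop : IsCoprime (2 * p) (q : ℤ) := h2.mul_left hpq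
  obtain ⟨u, v, huv⟩ := hcop
  set m := (-u) % q with hm
  have hm0 : 0 ≤ m := Int.emod_nonneg _ (by omega)
  have hm1 : m < q := Int.emod_lt_of_pos _ (by omega)
  have hdiv : -u = m + q * (-u / q) := (Int.emod_add_mul_ediv _ _).symm
  have hc : m * (2 * p) = (v - (-u / q) * (2 * p)) * q - 1 := by
    linear_combination (-2 * p) * hdiv - huv
  set c := v - (-u / q) * (2 * p) with hcdef
  have hodd : Odd c := by
    have : Odd (c * q) := ⟨m * p, by linear_combination - hc⟩
    exact (Int.odd_mul.1 this).1
  obtain ⟨j, hj⟩ := hodd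
  refine ⟨m.toNat, j, hq0, by omega, ?_, fun i hi => ?_⟩
  · rw [Int.toNat_of_nonneg hm0, hc, hj]
  · exact (IsCoprime.symm ⟨u, v, huv⟩).dvd_of_dvd_mul_right hi

namespace IsTongueData

variable {r} {q m : ℕ} {p j : ℤ}

lemma div_bounds (h : IsTongueData q m p j) {i : ℕ} (h0 : 0 < i) (h1 : i < q) :
    i * (2 * p) / q * q + 1 ≤ i * (2 * p) ∧ i * (2 * p) ≤ i * (2 * p) / q * q + q - 1 := by
  have hq : (0 : ℤ) < q := by exact_mod_cast h.pos
  have e := Int.emod_add_mul_ediv ((i : ℤ) * (2 * p)) q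
  have hlt := Int.emod_lt_of_pos ((i : ℤ) * (2 * p)) hq
  have hnn := Int.emod_nonneg ((i : ℤ) * (2 * p)) hq.ne'
  have hne : (i : ℤ) * (2 * p) % q ≠ 0 := fun h' => by
    have := Int.le_of_dvd (by exact_mod_cast h0) (h.dvd i (Int.dvd_of_emod_eq_zero h'))
    omega
  rw [mul_comm _ (q : ℤ)]
  omega

lemma div_add_div (h : IsTongueData q m p j) {i : ℕ} (h0 : 0 < i) (h1 : i < q) :
    (i : ℤ) * (2 * p) / q + ((q - i : ℕ) : ℤ) * (2 * p) / q = 2 * p - 1 := by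
  have hq : (0 : ℤ) < q := by exact_mod_cast h.pos
  have e1 := h.div_bounds h0 h1
  have e2 := h.div_bounds (i := q - i) (by omega) (by omega)
  push_cast [h1.le] at e2 ⊢
  set a := (i : ℤ) * (2 * p) / q
  set b := ((q : ℤ) - i) * (2 * p) / q
  have u1 : (a + b) * q < (2 * p) * q := by linarith
  have u2 : (2 * p) * q < (a + b + 2) * q := by linarith
  have := lt_of_mul_lt_mul_right u1 hq.le
  have := lt_of_mul_lt_mul_right u2 hq.le
  omega

lemma even_of_div_even (h : IsTongueData q m p j) {i : ℕ} (h0 : 0 < i) (h1 : i < q)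
    (he : Even ((i : ℤ) * (2 * p) / q)) : i * (2 * p) / q * q + 1 < i * (2 * p) := by
  refine lt_of_le_of_ne (h.div_bounds h0 h1).1 fun heq => ?_
  obtain ⟨b, hb⟩ := he.mul_right (q : ℤ)
  have : b + b + 1 = 2 * (i * p) := by rw [← hb, heq]; ring
  omega

lemma lt_of_lt_residue (h : IsTongueData q m p j) {i : ℕ} (h0 : 0 < i) (h1 : i < m) :
    i * (2 * p) + 1 < i * (2 * p) / q * q + q := by
  have hb := (h.div_bounds h0 (h1.trans h.lt)).2
  refine lt_of_le_of_ne (by linarith) fun heq => ?_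
  have : (q : ℤ) ∣ (m - i : ℤ) := h.dvd _ ⟨2 * j + 1 - (i * (2 * p) / q + 1), by
    linear_combination h.mul_eq - heq⟩
  have := Int.le_of_dvd (by omega) this
  have := h.lt
  omega

lemma iterate_left_mem_piece (h : IsTongueData q m p j) {t : ℝ}
    (hρ : ρ (trapLift r t) = p / q) (l : ℤ) {i : ℕ} (h0 : 0 < i) (h1 : i < q) :
    (trapLift r t)^[i] (bpt r l) ∈
      Icc (bpt r (l + i * (2 * p) / q)) (bpt r (l + i * (2 * p) / q + 1)) := by
  have hb := h.div_bounds h0 h1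
  refine ⟨(lt_iterate_bpt_of_rotation_eq r h.pos hρ l (by linarith)).le, ?_⟩
  rw [add_assoc]
  exact (iterate_bpt_lt_of_rotation_eq r h.pos hρ l (by linarith)).le

lemma iterate_right_lt (h : IsTongueData q m p j) {t : ℝ} (hρ : ρ (trapLift r t) = p / q) (l : ℤ) :
    (trapLift r t)^[m] (bpt r l) < bpt r (l + 1) + j := by
  have := iterate_bpt_lt_of_rotation_eq r h.pos hρ (n := m) (k := 2 * j + 1) l
    (by have := h.mul_eq; linarith)
  rwa [← bpt_add_two_mul, add_right_comm, add_assoc]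

lemma prod_pieceSlope (h : IsTongueData q m p j) :
    ∏ i ∈ Finset.Ico 1 q, pieceSlope r (1 + i * (2 * p) / q) = 1 := by
  refine prod_pieceSlope_eq_one r _ q fun i hi => ⟨p, ?_⟩
  rw [Finset.mem_Ico] at hi
  linear_combination h.div_add_div hi.1 hi.2

lemma translate_mem_Icc (h : IsTongueData q m p j) {t : ℝ}
    (ht : (trapLift r t)^[q] (bpt r 0) = bpt r 0 + p) :
    (trapLift r t)^[m] (bpt r 0) - j ∈ Icc (bpt r 0) (bpt r 1) := by
  have hρ := rotation_eq_of_iterate_eq r h.pos ht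
  have hq : (0 : ℤ) < q := by exact_mod_cast h.pos
  refine ⟨?_, by have := h.iterate_right_lt hρ 0; rw [zero_add] at this; linarith⟩
  rw [le_sub_iff_add_le, ← bpt_add_two_mul]
  rcases (show (1 : ℤ) ≤ q from hq).eq_or_lt with h1 | h1
  · have hm : m = 0 := by have := h.lt; omega
    have := h.mul_eq
    rw [hm, ← h1] at this
    have : j = 0 := by push_cast at this; omega
    simp [hm, this]
  · exact (lt_iterate_bpt_of_rotation_eq r h.pos hρ 0 (by have := h.mul_eq; linarith)).le

lemma iterate_translate_mem_piece (h : IsTongueData q m p j) {t : ℝ}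
    (ht : (trapLift r t)^[q] (bpt r 0) = bpt r 0 + p) {i : ℕ} (h0 : 0 < i) (h1 : i < q) :
    (trapLift r t)^[i] ((trapLift r t)^[m] (bpt r 0) - j) ∈
      Icc (bpt r (1 + i * (2 * p) / q)) (bpt r (1 + i * (2 * p) / q + 1)) := by
  have hρ := rotation_eq_of_iterate_eq r h.pos ht
  have hq : (0 : ℤ) < q := by exact_mod_cast h.pos
  refine ⟨?_, ((trapLift r t).monotone.iterate i (h.translate_mem_Icc ht).2).trans
    (h.iterate_left_mem_piece hρ 1 h0 h1).2⟩
  rw [iterate_sub_int, ← Function.iterate_add_apply, le_sub_iff_add_le, ← bpt_add_two_mul]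
  have hb := h.div_bounds h0 h1
  rcases hb.1.eq_or_lt with heq | hlt
  · have hdvd : (q : ℤ) ∣ ((i + m : ℕ) : ℤ) := h.dvd _ ⟨i * (2 * p) / q + (2 * j + 1), by
      push_cast
      linear_combination h.mul_eq - heq⟩
    have hiq : i + m = q := by
      obtain ⟨a, ha⟩ := hdvd
      have := h.lt
      have ha0 : 0 < a := pos_of_mul_pos_right (by omega : 0 < (q : ℤ) * a) hq.le
      have ha2 : a < 2 := lt_of_mul_lt_mul_left (by omega : (q : ℤ) * a < q * 2) hq.le
      obtain rfl : a = 1 := by omega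
      omega
    have hk : i * (2 * p) / q + (2 * j + 1) = 2 * p := by
      have hs : ((i : ℤ) + m) = q := by exact_mod_cast hiq
      refine mul_right_cancel₀ hq.ne' ?_
      linear_combination heq - h.mul_eq + 2 * p * hs
    rw [hiq, ht, ← bpt_add_two_mul]
    refine ((bpt_strictMono r).monotone ?_)
    omega
  · have := lt_iterate_bpt_of_rotation_eq r h.pos hρ (n := i + m)
      (k := 1 + i * (2 * p) / q + 2 * j) 0 (by
        have := h.mul_eq
        push_cast
        linarith)
    rw [zero_add] at this
    exact this.le

lemma iterate_sub_eq (h : IsTongueData q m p j) {t : ℝ}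
    (ht : (trapLift r t)^[q] (bpt r 0) = bpt r 0 + p) :
    bpt r 1 + p - (trapLift r t)^[q] (bpt r 1) =
      (1 - (expansion r)⁻¹) * (bpt r 1 - ((trapLift r t)^[m] (bpt r 0) - j)) := by
  have hρ := rotation_eq_of_iterate_eq r h.pos ht
  set u := (trapLift r t)^[m] (bpt r 0) - j with hu
  have hfix : (trapLift r t)^[q] u = u + p := by
    rw [hu, iterate_sub_int, ← Function.iterate_add_apply, add_comm q m,
      Function.iterate_add_apply, ht, iterate_add_int]
    ring
  have hmem := h.translate_mem_Icc ht
  obtain ⟨n, rfl⟩ : ∃ n, q = n + 1 := ⟨q - 1, by have := h.pos; omega⟩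
  have hprod := iterate_sub_eq_prod_mul r (fun i => 1 + i * (2 * p) / ((n + 1 : ℕ) : ℤ)) n
    (t := t) (x := u) (y := bpt r 1)
    (fun i hi => by
      rw [Finset.mem_Ico] at hi
      exact h.iterate_translate_mem_piece ht hi.1 hi.2)
    (fun i hi => by
      rw [Finset.mem_Ico] at hi
      exact h.iterate_left_mem_piece hρ 1 hi.1 hi.2)
  have hone : bpt r 1 ∈ Icc (bpt r 0) (bpt r (0 + 1)) :=
    right_mem_Icc.2 (bpt_lt_succ r 0).le
  have hs := baseLift_sub_of_mem_piece r (k := 0) (x := u) hmem hone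
  rw [pieceSlope_of_even r Even.zero] at hs
  rw [h.prod_pieceSlope, one_mul, hfix, hs] at hprod
  linear_combination -hprod

lemma distortion (h : IsTongueData q m p j) {t z : ℝ} (hρ : ρ (trapLift r t) = p / q)
    (hz : z = (trapLift r t)^[m] (bpt r 1) - 1 - j) (hzA : z ≤ bpt r 0)
    (hK : (trapLift r t)^[m] (-baseLift r z) = bpt r 1 + j) {i : ℕ} (hi : i + 1 ≤ m) :
    (trapLift r t)^[i + 1] (bpt r 0) - (trapLift r t)^[i + 1] z ≤ expansion r ^ 3 *
      ((trapLift r t)^[i + 1] (-baseLift r z) - (trapLift r t)^[i + 1] (bpt r 0)) := by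
  have hL := expansion_pos r
  have hLi : expansion r * (expansion r)⁻¹ = 1 := mul_inv_cancel₀ hL.ne'
  have hA : -baseLift r (bpt r 0) = bpt r 0 := by rw [baseLift_bpt, neg_zero, neg_neg]
  have hAK : bpt r 0 ≤ -baseLift r z := by
    rw [← hA]; exact neg_le_neg ((baseLift_strictMono r).monotone hzA)
  have low : ∀ {x y : ℝ}, x ≤ y →
      y - x ≤ expansion r * (baseLift r y - baseLift r x) := fun hxy => by
    have := mul_le_mul_of_nonneg_left (inv_expansion_mul_le_baseLift_sub r hxy) hL.le
    rwa [← mul_assoc, hLi, one_mul] at this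
  induction i with
  | zero =>
    simp only [zero_add, Function.iterate_one, trapLift_apply, add_sub_add_right_eq_sub]
    have h0 := low hzA
    have h1 := low hAK
    have h2 := baseLift_sub_le_expansion_mul r hzA
    have h3 : bpt r 0 - z ≤ expansion r * (-baseLift r z - bpt r 0) := by
      linear_combination h0 + (-expansion r) * hA
    have h4 := h3.trans (mul_le_mul_of_nonneg_left h1 hL.le)
    calc _ ≤ expansion r * (bpt r 0 - z) := h2
      _ ≤ expansion r * (expansion r * (expansion r *
          (baseLift r (-baseLift r z) - baseLift r (bpt r 0)))) :=
        mul_le_mul_of_nonneg_left h4 hL.le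
      _ = _ := by ring
  | succ i ih =>
    have ih := ih (by omega)
    have hmon := (trapLift r t).monotone.iterate (i + 1)
    have o1 := hmon hzA
    have o2 := hmon hAK
    have hi0 : 0 < i + 1 := by omega
    have hiq : i + 1 < q := by have := h.lt; omega
    have hpA := h.iterate_left_mem_piece hρ 0 hi0 hiq
    rw [zero_add] at hpA
    rw [Function.iterate_succ_apply' _ (i + 1), Function.iterate_succ_apply' _ (i + 1),
      Function.iterate_succ_apply' _ (i + 1), trapLift_apply, trapLift_apply, trapLift_apply,
      add_sub_add_right_eq_sub, add_sub_add_right_eq_sub]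
    set a := (trapLift r t)^[i + 1] (bpt r 0)
    set b := (trapLift r t)^[i + 1] (-baseLift r z)
    set y := (trapLift r t)^[i + 1] z with hy
    set k := ((i + 1 : ℕ) : ℤ) * (2 * p) / q with hk
    rcases Int.even_or_odd k with hev | hodd
    · have hyk : bpt r k ≤ y := by
        have hz1 : z = (trapLift r t)^[m] (bpt r 1) - (1 + j : ℤ) := by
          rw [hz]; push_cast; ring
        have := lt_iterate_bpt_of_rotation_eq r h.pos hρ (n := i + 1 + m)
          (k := k + (2 * j + 1)) 1 (by
            have := h.mul_eq
            have := h.even_of_div_even hi0 hiq hev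
            rw [← hk] at this
            push_cast at this ⊢
            linarith)
        rw [show 1 + (k + (2 * j + 1)) = k + 2 * (1 + j) by ring, bpt_add_two_mul] at this
        rw [hy, hz1, iterate_sub_int, le_sub_iff_add_le, ← Function.iterate_add_apply]
        exact this.le
      have s := baseLift_sub_of_mem_piece r ⟨hyk, o1.trans hpA.2⟩ hpA
      rw [pieceSlope_of_even r hev] at s
      rw [s]
      calc _ ≤ (expansion r)⁻¹ * (expansion r ^ 3 * (b - a)) := by gcongr
        _ = expansion r ^ 3 * ((expansion r)⁻¹ * (b - a)) := by ring
        _ ≤ _ := by gcongr; exact inv_expansion_mul_le_baseLift_sub r o2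
    · have hbk : b ≤ bpt r (k + 1) := by
        by_contra! hlt
        have hm : m = (m - (i + 1)) + (i + 1) := by omega
        have := lt_iterate_bpt_of_rotation_eq r h.pos hρ (n := m - (i + 1))
          (k := 2 * j - k) (k + 1) (by
            have e := h.mul_eq
            have := h.lt_of_lt_residue hi0 (by omega)
            rw [← hk] at this
            push_cast [show i + 1 ≤ m by omega] at this ⊢
            linarith)
        rw [show k + 1 + (2 * j - k) = 1 + 2 * j by ring, bpt_add_two_mul, ← hK, hm,
          Function.iterate_add_apply] at this
        simp only [Nat.add_sub_cancel] at this
        exact absurd (((trapLift r t).monotone.iterate _) hlt.le) (not_le.2 this)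
      have s := baseLift_sub_of_mem_piece r hpA ⟨hpA.1.trans o2, hbk⟩
      rw [pieceSlope_of_odd r hodd] at s
      rw [s]
      calc _ ≤ expansion r * (a - y) := baseLift_sub_le_expansion_mul r o1
        _ ≤ expansion r * (expansion r ^ 3 * (b - a)) := by gcongr
        _ = _ := by ring

lemma sub_iterate_le (h : IsTongueData q m p j) {t : ℝ} (hρ : ρ (trapLift r t) = p / q) :
    bpt r 1 - ((trapLift r t)^[m + m] (bpt r 1) - (2 * j + 1 : ℤ)) ≤
      (1 + expansion r ^ 3) * (bpt r 1 - ((trapLift r t)^[m] (bpt r 0) - j)) := by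
  have hL := expansion_pos r
  set z := (trapLift r t)^[m] (bpt r 1) - 1 - j with hz
  have hz' : (trapLift r t)^[m] (bpt r 1) = z + (1 + j : ℤ) := by rw [hz]; push_cast; ring
  have hzA : z ≤ bpt r 0 := by
    have := h.iterate_right_lt hρ 1
    rw [show (1 : ℤ) + 1 = 0 + 2 * 1 by norm_num, bpt_add_two_mul] at this
    push_cast at this
    linarith
  have hK : (trapLift r t)^[m] (-baseLift r z) = bpt r 1 + j := by
    have hg : baseLift r ((trapLift r t)^[m] (bpt r 1)) = baseLift r z + (1 + j : ℤ) := by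
      have := (trapLift r 0).map_add_int z (1 + j)
      rw [trapLift_apply, trapLift_apply, add_zero, add_zero] at this
      rw [hz', this]
    have := iterate_neg_baseLift_iterate r t m (bpt r 1)
    rw [hg, neg_add', iterate_sub_int, baseLift_bpt, bpt_neg] at this
    push_cast at this
    linarith
  have hm : (trapLift r t)^[m + m] (bpt r 1) = (trapLift r t)^[m] z + (1 + j : ℤ) := by
    rw [Function.iterate_add_apply, hz', iterate_add_int]
  have key : (trapLift r t)^[m] (bpt r 0) - (trapLift r t)^[m] z ≤ expansion r ^ 3 *
      ((trapLift r t)^[m] (-baseLift r z) - (trapLift r t)^[m] (bpt r 0)) := by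
    rcases Nat.eq_zero_or_pos m with h0 | h0
    · have hA : -baseLift r (bpt r 0) = bpt r 0 := by rw [baseLift_bpt, neg_zero, neg_neg]
      have h1 := inv_expansion_mul_le_baseLift_sub r hzA
      have hnn : 0 ≤ -baseLift r z - bpt r 0 := by
        have := (baseLift_strictMono r).monotone hzA
        linarith
      have h2 : bpt r 0 - z ≤ expansion r * (-baseLift r z - bpt r 0) := by
        have := mul_le_mul_of_nonneg_left h1 hL.le
        rw [← mul_assoc, mul_inv_cancel₀ hL.ne', one_mul] at this
        linear_combination this + (-expansion r) * hA
      rw [h0]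
      refine h2.trans (mul_le_mul_of_nonneg_right ?_ hnn)
      exact le_self_pow₀ (one_lt_expansion r).le (by norm_num)
    · obtain ⟨i, hi⟩ : ∃ i, m = i + 1 := ⟨m - 1, by omega⟩
      have := h.distortion hρ hz hzA hK (i := i) (by omega)
      rwa [← hi] at this
  rw [hK] at key
  rw [hm]
  push_cast
  linarith

lemma iterate_le_of_rotation_lt (h : IsTongueData q m p j) {t₀ t : ℝ}
    (ht : (trapLift r t)^[q] (bpt r 1) ≤ bpt r 1 + p) (hle : t₀ ≤ t)
    (hclose : (2 * p : ℝ) / q - 1 / q ^ 2 < 2 * ρ (trapLift r t₀)) :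
    (trapLift r t)^[m + m] (bpt r 1) - (2 * j + 1 : ℤ) ≤
      (trapLift r t₀)^[q] (bpt r 1) - p := by
  have hq : (0 : ℝ) < q := by exact_mod_cast h.pos
  obtain ⟨l, n, hl, hn, hlow⟩ : ∃ l n : ℕ, n + (m + m) = l * q ∧ n ≤ q ∧
      (trapLift r t)^[l * q] (bpt r 1) ≤ bpt r 1 + (l * p : ℤ) := by
    have := h.lt
    rcases le_total (m + m) q with h1 | h1
    · exact ⟨1, q - (m + m), by omega, by omega, by simpa using ht⟩
    · refine ⟨2, 2 * q - (m + m), by omega, by omega, ?_⟩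
      rw [two_mul, Function.iterate_add_apply]
      have h2 := (trapLift r t).monotone.iterate q ht
      rw [iterate_add_int] at h2
      push_cast
      linarith
  have hup := lt_iterate_bpt r (t := t₀) (n := n + q)
    (k := 2 * (l * p + p - (2 * j + 1))) 1 (by
      have e : (m : ℝ) * (2 * p) = (2 * j + 1) * q - 1 := by exact_mod_cast h.mul_eq
      have en : (n : ℝ) = l * q - 2 * m := by
        have : (n : ℝ) + (m + m) = l * q := by exact_mod_cast hl
        linarith
      have hnq : (n : ℝ) ≤ q := by exact_mod_cast hn
      have hn0 : (0 : ℝ) ≤ n := Nat.cast_nonneg n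
      have hpos : (0 : ℝ) < n + q := by linarith
      have h1 : ((n : ℝ) + q) * ((2 * p : ℝ) / q - 1 / q ^ 2) <
          (n + q) * (2 * ρ (trapLift r t₀)) := mul_lt_mul_of_pos_left hclose hpos
      have h2 : ((n : ℝ) + q) * ((2 * p : ℝ) / q - 1 / q ^ 2) =
          2 * (l * p + p - (2 * j + 1)) + (q - n) / q ^ 2 := by
        field_simp
        rw [en]
        linear_combination (-2 * q : ℝ) * e
      have h3 : 0 ≤ ((q : ℝ) - n) / q ^ 2 := by
        have : 0 ≤ (q : ℝ) - n := by linarith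
        positivity
      push_cast
      linarith)
  rw [bpt_add_two_mul, Function.iterate_add_apply] at hup
  have hchain := iterate_le_iterate_of_le r hle n ((trapLift r t)^[m + m] (bpt r 1))
  rw [← Function.iterate_add_apply, hl] at hchain
  by_contra! hlt
  have h4 : (trapLift r t₀)^[q] (bpt r 1) ≤
      (trapLift r t)^[m + m] (bpt r 1) + (p - (2 * j + 1) : ℤ) := by
    push_cast at hlt ⊢
    linarith
  have h5 := (trapLift r t₀).monotone.iterate n h4
  rw [iterate_add_int] at h5
  push_cast at h5 hlow hup
  linarith

end IsTongueData

/-- The constant comparing the distance to a tongue with the length of the tongue. -/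
noncomputable def tongueConst : ℝ := (1 + expansion r ^ 3) / (1 - (expansion r)⁻¹)

lemma tongueConst_pos : 0 < tongueConst r := by
  have := expansion_pos r
  have := inv_expansion_lt_one r
  exact div_pos (by positivity) (by linarith)

lemma tongue_le {q : ℕ} {p : ℤ} (hq : Odd q) (hpq : IsCoprime p q) {t₁ t₂ : ℝ}
    (h₁ : (trapLift r t₁)^[q] (bpt r 0) = bpt r 0 + p)
    (h₂ : (trapLift r t₂)^[q] (bpt r 1) = bpt r 1 + p) : t₁ ≤ t₂ := by
  obtain ⟨m, j, h⟩ := exists_isTongueData hq hpq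
  have he := h.iterate_sub_eq h₁
  have hu := (h.translate_mem_Icc h₁).2
  by_contra! hlt
  have hq1 : (trapLift r t₁)^[q] (bpt r 1) ≤ (trapLift r t₂)^[q] (bpt r 1) := by
    have := mul_nonneg (sub_nonneg.2 (inv_expansion_lt_one r).le) (sub_nonneg.2 hu)
    linarith
  exact hq1.not_gt (iterate_lt_iterate_of_lt r hlt h.pos _)

lemma sub_le_tongueConst_mul {q : ℕ} {p : ℤ} (hq : Odd q) (hpq : IsCoprime p q) {t₀ t₁ t₂ : ℝ}
    (h₁ : (trapLift r t₁)^[q] (bpt r 0) = bpt r 0 + p)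
    (h₂ : (trapLift r t₂)^[q] (bpt r 1) = bpt r 1 + p)
    (hlt : 2 * ρ (trapLift r t₀) < (2 * p : ℝ) / q)
    (hclose : (2 * p : ℝ) / q - 1 / q ^ 2 < 2 * ρ (trapLift r t₀)) :
    t₂ - t₀ ≤ tongueConst r * (t₂ - t₁) := by
  obtain ⟨m, j, h⟩ := exists_isTongueData hq hpq
  have hρ₁ := rotation_eq_of_iterate_eq r h.pos h₁
  have hρ₂ := rotation_eq_of_iterate_eq r h.pos h₂
  have hqR : (0 : ℝ) < q := by exact_mod_cast h.pos
  have hle : t₀ ≤ t₁ := by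
    by_contra! hgt
    have := CircleDeg1Lift.translationNumber_mono (trapLift_mono r hgt.le)
    rw [hρ₁] at this
    rw [mul_div_assoc] at hlt
    linarith
  have he := h.iterate_sub_eq h₁
  have hu := (h.translate_mem_Icc h₁).2
  have hΛ := inv_expansion_lt_one r
  have hnn := mul_nonneg (sub_nonneg.2 hΛ.le) (sub_nonneg.2 hu)
  have hβ := h.iterate_le_of_rotation_lt (by linarith) hle hclose
  have hd := h.sub_iterate_le hρ₁
  have hmem₀ : ∀ {i : ℕ}, 0 < i → i < q → (trapLift r t₀)^[i] (bpt r 1) ∈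
      Icc (bpt r (1 + i * (2 * p) / q)) (bpt r (1 + i * (2 * p) / q + 1)) := by
    intro i h0 h1
    obtain ⟨hb1, hb2⟩ := h.div_bounds h0 h1
    set k := (i : ℤ) * (2 * p) / q
    have hb1' : (k : ℝ) * q + 1 ≤ i * (2 * p) := by exact_mod_cast hb1
    have hb2' : (i : ℝ) * (2 * p) ≤ k * q + q - 1 := by exact_mod_cast hb2
    have hi0 : (0 : ℝ) < i := by exact_mod_cast h0
    have hiq : (i : ℝ) < q := by exact_mod_cast h1
    refine ⟨(lt_iterate_bpt r 1 ?_).le, ?_⟩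
    · have h2 := mul_lt_mul_of_pos_left hclose hi0
      have h3 : (k : ℝ) + (1 / q - i / q ^ 2) ≤ i * ((2 * p : ℝ) / q - 1 / q ^ 2) := by
        have : (i : ℝ) * ((2 * p : ℝ) / q - 1 / q ^ 2) = (i * (2 * p)) / q - i / q ^ 2 := by
          ring
        rw [this]
        have : (k : ℝ) + 1 / q ≤ (i * (2 * p)) / q := by
          rw [le_div_iff₀ hqR, add_mul, one_div, inv_mul_cancel₀ hqR.ne']
          exact hb1'
        linarith
      have h4 : 0 < 1 / (q : ℝ) - i / q ^ 2 := by
        have : 1 / (q : ℝ) - i / q ^ 2 = (q - i) / q ^ 2 := by field_simp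
        rw [this]
        have : 0 < (q : ℝ) - i := by linarith
        positivity
      linarith
    · rw [add_assoc]
      refine (iterate_bpt_lt r 1 ?_).le
      have h2 := mul_lt_mul_of_pos_left hlt hi0
      have h3 : (i : ℝ) * ((2 * p : ℝ) / q) ≤ k + 1 := by
        rw [← mul_div_assoc, div_le_iff₀ hqR]
        linarith
      push_cast
      linarith
  obtain ⟨n, rfl⟩ : ∃ n, q = n + 1 := ⟨q - 1, by have := h.pos; omega⟩
  obtain ⟨C, hC, hCeq⟩ := exists_iterate_sub_eq_mul r
    (fun i => 1 + i * (2 * p) / ((n + 1 : ℕ) : ℤ)) (bpt r 1) n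
  have hmem : ∀ {t : ℝ}, ρ (trapLift r t) = p / ((n + 1 : ℕ) : ℝ) →
      ∀ i ∈ Finset.Ico 1 (n + 1), (trapLift r t)^[i] (bpt r 1) ∈
        Icc (bpt r (1 + i * (2 * p) / ((n + 1 : ℕ) : ℤ)))
          (bpt r (1 + i * (2 * p) / ((n + 1 : ℕ) : ℤ) + 1)) := fun hρ i hi => by
    rw [Finset.mem_Ico] at hi
    exact h.iterate_left_mem_piece hρ 1 hi.1 hi.2
  have hm₀ : ∀ i ∈ Finset.Ico 1 (n + 1), (trapLift r t₀)^[i] (bpt r 1) ∈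
        Icc (bpt r (1 + i * (2 * p) / ((n + 1 : ℕ) : ℤ)))
          (bpt r (1 + i * (2 * p) / ((n + 1 : ℕ) : ℤ) + 1)) := fun i hi => by
    rw [Finset.mem_Ico] at hi
    exact hmem₀ hi.1 hi.2
  have e1 := hCeq t₁ t₂ (hmem hρ₁) (hmem hρ₂)
  have e0 := hCeq t₀ t₂ hm₀ (hmem hρ₂)
  rw [h₂] at e1 e0
  rw [tongueConst, div_mul_eq_mul_div, le_div_iff₀ (by linarith)]
  refine le_of_mul_le_mul_left ?_ hC
  set w := bpt r 1 - ((trapLift r t₁)^[m] (bpt r 0) - j)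
  calc C * ((t₂ - t₀) * (1 - (expansion r)⁻¹))
      = (C * (t₂ - t₀)) * (1 - (expansion r)⁻¹) := by ring
    _ ≤ ((1 + expansion r ^ 3) * w) * (1 - (expansion r)⁻¹) := by
        refine mul_le_mul_of_nonneg_right ?_ (by linarith)
        linarith
    _ = (1 + expansion r ^ 3) * (C * (t₂ - t₁)) := by rw [← e1, he]; ring
    _ = C * ((1 + expansion r ^ 3) * (t₂ - t₁)) := by ring

lemma bpt_one_sub (k : ℤ) : bpt r (1 - k) = bpt r 0 + bpt r 1 - bpt r k := by
  by_cases hk : Even k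
  · simp [bpt, Int.even_sub, hk]; ring
  · simp [bpt, Int.even_sub, hk]; ring

lemma baseLift_reflect (x : ℝ) :
    baseLift r (bpt r 0 + bpt r 1 - x) = bpt r 1 - bpt r 0 - baseLift r x := by
  obtain ⟨k, hk⟩ := exists_mem_piece r x
  have e1 := bpt_one_sub r k
  have e2 := bpt_one_sub r (k + 1)
  rw [show 1 - (k + 1) = -k by ring] at e2
  have hmem : bpt r 0 + bpt r 1 - x ∈ Icc (bpt r (-k)) (bpt r (-k + 1)) := by
    rw [show -k + 1 = 1 - k by ring, e1, e2]
    constructor <;> linarith [hk.1, hk.2]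
  have hs := baseLift_sub_of_mem_piece r hmem (right_mem_Icc.2 (bpt_lt_succ r (-k)).le)
  have hslope : pieceSlope r (-k) = pieceSlope r k := by simp [pieceSlope]
  rw [show -k + 1 = 1 - k by ring, baseLift_bpt, neg_sub, e1, hslope] at hs
  rw [baseLift_of_mem_piece r hk]
  have e3 : bpt r (-k) + bpt r (k - 1) = bpt r 0 - bpt r 1 := by
    have := bpt_one_sub r (-k)
    rw [show 1 - -k = k - 1 + 2 * 1 by ring, bpt_add_two_mul] at this
    have h1 := bpt_odd r 0
    have h0 := bpt_even r 0
    have hneg := bpt_neg r 1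
    push_cast at *
    simp only [zero_add] at h0 h1
    linarith
  linear_combination -hs - e3

lemma trapLift_iterate_reflect (t : ℝ) (n : ℕ) (x : ℝ) :
    (trapLift r (2 * bpt r 0 - t))^[n] (bpt r 0 + bpt r 1 - x) =
      bpt r 0 + bpt r 1 - (trapLift r t)^[n] x := by
  induction n with
  | zero => rfl
  | succ n ih =>
    rw [Function.iterate_succ_apply', ih, trapLift_apply, baseLift_reflect,
      Function.iterate_succ_apply', trapLift_apply]
    ring

lemma rotation_reflect (t : ℝ) : ρ (trapLift r (2 * bpt r 0 - t)) = -ρ (trapLift r t) := by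
  have h1 := (trapLift r (2 * bpt r 0 - t)).tendsto_translationNumber (bpt r 0 + bpt r 1 - 0)
  have h2 := ((trapLift r t).tendsto_translationNumber 0).neg
  refine tendsto_nhds_unique h1 (h2.congr fun n => ?_)
  rw [CircleDeg1Lift.coe_pow, CircleDeg1Lift.coe_pow, trapLift_iterate_reflect, ← neg_div]
  congr 1
  ring

lemma mem_Icc_of_rotation_near {q : ℕ} {p : ℤ} (hq : Odd q) (hpq : IsCoprime p q) {t₀ t₁ t₂ : ℝ}
    (h₁ : (trapLift r t₁)^[q] (bpt r 0) = bpt r 0 + p)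
    (h₂ : (trapLift r t₂)^[q] (bpt r 1) = bpt r 1 + p)
    (hne : ρ (trapLift r t₀) ≠ p / q)
    (hclose : |ρ (trapLift r t₀) - p / q| < 1 / (2 * q ^ 2)) :
    t₀ ∈ Icc (t₂ - tongueConst r * (t₂ - t₁)) (t₁ + tongueConst r * (t₂ - t₁)) := by
  have hρ₁ := rotation_eq_of_iterate_eq r hq.pos h₁
  have hρ₂ := rotation_eq_of_iterate_eq r hq.pos h₂
  have hτ := tongue_le r hq hpq h₁ h₂
  have hM := mul_nonneg (tongueConst_pos r).le (sub_nonneg.2 hτ)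
  have e1 : (2 * p : ℝ) / q = 2 * (p / q) := by ring
  have e2 : 1 / (q : ℝ) ^ 2 = 2 * (1 / (2 * q ^ 2)) := by
    have : (q : ℝ) ≠ 0 := by exact_mod_cast hq.pos.ne'
    field_simp
  rw [abs_lt] at hclose
  rcases hne.lt_or_gt with hlt | hgt
  · have h := sub_le_tongueConst_mul r hq hpq (t₀ := t₀) h₁ h₂ (by linarith) (by linarith)
    have hle : t₀ ≤ t₁ := by
      by_contra! hgt
      have := CircleDeg1Lift.translationNumber_mono (trapLift_mono r hgt.le)
      linarith
    constructor <;> linarith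
  · have hA : bpt r 0 = bpt r 0 + bpt r 1 - bpt r 1 := by ring
    have hB : bpt r 1 = bpt r 0 + bpt r 1 - bpt r 0 := by ring
    have g₁ : (trapLift r (2 * bpt r 0 - t₂))^[q] (bpt r 0) = bpt r 0 + (-p : ℤ) := by
      have := trapLift_iterate_reflect r t₂ q (bpt r 1)
      rw [← hA, h₂] at this
      push_cast
      linarith
    have g₂ : (trapLift r (2 * bpt r 0 - t₁))^[q] (bpt r 1) = bpt r 1 + (-p : ℤ) := by
      have := trapLift_iterate_reflect r t₁ q (bpt r 0)
      rw [← hB, h₁] at this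
      push_cast
      linarith
    have e3 : (2 * ((-p : ℤ) : ℝ)) / q = -(2 * (p / q)) := by push_cast; ring
    have hr := rotation_reflect r t₀
    have h := sub_le_tongueConst_mul r hq hpq.neg_left (t₀ := 2 * bpt r 0 - t₀) g₁ g₂
      (by linarith) (by linarith)
    have hle : t₂ ≤ t₀ := by
      by_contra! hlt
      have := CircleDeg1Lift.translationNumber_mono (trapLift_mono r hlt.le)
      linarith
    have h' : t₀ - t₁ ≤ tongueConst r * (t₂ - t₁) := by linear_combination h
    constructor <;> linarith

lemma iterate_bpt_one_eq_of_even {t : ℝ} {m : ℕ} {j : ℤ}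
    (h : (trapLift r t)^[m + m] (bpt r 0) = bpt r 0 + (2 * j + 1 : ℤ)) :
    (trapLift r t)^[m + m] (bpt r 1) = bpt r 1 + (2 * j + 1 : ℤ) := by
  have hinj := ((trapLift_strictMono r t).iterate m).injective
  set y := (trapLift r t)^[m] (bpt r 0) with hy
  rw [Function.iterate_add_apply, ← hy] at h
  have hA : -baseLift r (bpt r 0) = bpt r 0 := by rw [baseLift_bpt, neg_zero, neg_neg]
  have hB : baseLift r (bpt r 1) = 1 - bpt r 1 := by
    rw [baseLift_bpt, bpt_neg]; push_cast; ring
  have hrev := iterate_neg_baseLift_iterate r t m (bpt r 0)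
  rw [hA, ← hy] at hrev
  have hsum : y = -baseLift r y + (2 * j + 1 : ℤ) := by
    refine hinj ?_
    rw [iterate_add_int, hrev, h]
  have hBj : baseLift r (bpt r 1 + j) = 1 - bpt r 1 + j := by
    have := (trapLift r 0).map_add_int (bpt r 1) j
    rwa [trapLift_apply, trapLift_apply, add_zero, add_zero, hB] at this
  have hyB : y = bpt r 1 + j := by
    push_cast at hsum
    rcases lt_trichotomy y (bpt r 1 + j) with hlt | heq | hgt
    · have := baseLift_strictMono r hlt
      linarith
    · exact heq
    · have := baseLift_strictMono r hgt
      linarith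
  rw [hyB, iterate_add_int] at h
  rw [Function.iterate_add_apply, show (trapLift r t)^[m] (bpt r 1) =
    bpt r 0 + (j + 1 : ℤ) by push_cast at h ⊢; linarith, iterate_add_int, ← hy, hyB]
  push_cast
  ring

lemma exists_mem_Ico_piece (x : ℝ) : ∃ k : ℤ, x ∈ Ico (bpt r k) (bpt r (k + 1)) := by
  obtain ⟨k, hk⟩ := exists_mem_piece r x
  rcases hk.2.lt_or_eq with h | h
  · exact ⟨k, hk.1, h⟩
  · exact ⟨k + 1, h.ge, h.trans_lt (bpt_lt_succ r _)⟩

lemma exists_iterate_sub_eq_mul_of_forall_bpt {t u v : ℝ} {n : ℕ}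
    (h : ∀ i < n, ∀ k : ℤ, bpt r k ∉ Ioo ((trapLift r t)^[i] u) ((trapLift r t)^[i] v)) :
    ∃ S : ℝ, ∀ w ∈ Icc u v, (trapLift r t)^[n] w - (trapLift r t)^[n] u = S * (w - u) := by
  induction n with
  | zero => exact ⟨1, fun w _ => by simp⟩
  | succ n ih =>
    obtain ⟨S, hS⟩ := ih fun i hi => h i (hi.trans n.lt_succ_self)
    obtain ⟨k, hk⟩ := exists_mem_Ico_piece r ((trapLift r t)^[n] u)
    have hv : (trapLift r t)^[n] v ≤ bpt r (k + 1) := by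
      by_contra! hlt
      exact h n n.lt_succ_self (k + 1) ⟨hk.2, hlt⟩
    refine ⟨pieceSlope r k * S, fun w hw => ?_⟩
    have hmon := (trapLift r t).monotone.iterate n
    rw [Function.iterate_succ_apply', Function.iterate_succ_apply', trapLift_apply,
      trapLift_apply, add_sub_add_right_eq_sub, baseLift_sub_of_mem_piece r ⟨hk.1, hk.2.le⟩
      ⟨hk.1.trans (hmon hw.1), (hmon hw.2).trans hv⟩, hS w hw, mul_assoc]

lemma iterate_eq_add_int_of_forall_bpt {t : ℝ} {q : ℕ} {p : ℤ}
    (h : ∀ k : ℤ, (trapLift r t)^[q] (bpt r k) = bpt r k + p) (x : ℝ) :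
    (trapLift r t)^[q] x = x + p := by
  set Z := {y : ℝ | (trapLift r t)^[q] y = y + p} with hZ
  have hclosed : IsClosed Z :=
    isClosed_eq ((continuous_trapLift r t).iterate q) (by fun_prop)
  have hinv : ∀ (i : ℕ) (y : ℝ), (trapLift r t)^[i] y ∈ Z → y ∈ Z := fun i y hy => by
    refine ((trapLift_strictMono r t).iterate i).injective ?_
    rw [iterate_add_int, ← Function.iterate_add_apply, add_comm, Function.iterate_add_apply]
    exact hy
  obtain ⟨k, hk⟩ := exists_mem_piece r x
  have ne1 : (Z ∩ Iic x).Nonempty := ⟨_, h k, hk.1⟩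
  have ne2 : (Z ∩ Ici x).Nonempty := ⟨_, h (k + 1), hk.2⟩
  have bd1 : BddAbove (Z ∩ Iic x) := ⟨x, fun y hy => hy.2⟩
  have bd2 : BddBelow (Z ∩ Ici x) := ⟨x, fun y hy => hy.2⟩
  have hu := (hclosed.inter isClosed_Iic).csSup_mem ne1 bd1
  have hv := (hclosed.inter isClosed_Ici).csInf_mem ne2 bd2
  have hgap : ∀ y ∈ Z, y ∉ Ioo (sSup (Z ∩ Iic x)) (sInf (Z ∩ Ici x)) := fun y hy hy' => by
    rcases le_total y x with hyx | hyx
    · exact (le_csSup bd1 ⟨hy, hyx⟩).not_gt hy'.1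
    · exact (csInf_le bd2 ⟨hy, hyx⟩).not_gt hy'.2
  set u := sSup (Z ∩ Iic x)
  set v := sInf (Z ∩ Ici x)
  have hux : u ≤ x := hu.2
  have hxv : x ≤ v := hv.2
  obtain ⟨S, hS⟩ := exists_iterate_sub_eq_mul_of_forall_bpt r (t := t) (u := u) (v := v) (n := q)
    fun i _ l hl => by
      obtain ⟨w, hw, hwl⟩ := intermediate_value_Ioo (hux.trans hxv)
        ((continuous_trapLift r t).iterate i).continuousOn hl
      exact hgap w (hinv i w (by rw [hwl]; exact h l)) hw
  have hqu : (trapLift r t)^[q] u = u + p := hu.1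
  have hqv : (trapLift r t)^[q] v = v + p := hv.1
  have h1 := hS x ⟨hux, hxv⟩
  have h2 := hS v ⟨hux.trans hxv, le_rfl⟩
  rcases (hux.trans hxv).eq_or_lt with heq | hlt
  · rw [show x = u by linarith, hqu]
  · have hS1 : S = 1 := by
      refine mul_right_cancel₀ (sub_ne_zero.2 hlt.ne') ?_
      linarith
    rw [hS1] at h1
    linarith

lemma eq_of_rotation_eq_of_even {t₁ : ℝ} {q : ℕ} {p : ℤ} (hq : 0 < q) (heven : Even q)
    (hp : Odd p) (h : (trapLift r t₁)^[q] (bpt r 0) = bpt r 0 + p) {t : ℝ}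
    (hρ : ρ (trapLift r t) = p / q) : t = t₁ := by
  obtain ⟨m, rfl⟩ := heven
  obtain ⟨j, rfl⟩ := hp
  have hB := iterate_bpt_one_eq_of_even r h
  have hall := iterate_eq_add_int_of_forall_bpt r (t := t₁) (q := m + m) (p := 2 * j + 1)
    fun k => by
      rcases Int.even_or_odd' k with ⟨i, rfl | rfl⟩
      · rw [← zero_add (2 * i), bpt_add_two_mul, iterate_add_int, h]; ring
      · rw [add_comm (2 * i), bpt_add_two_mul, iterate_add_int, hB]; ring
  have hq' : ((m + m : ℕ) : ℝ) ≠ 0 := by exact_mod_cast hq.ne'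
  have hpow : ρ (trapLift r t ^ (m + m)) = ((2 * j + 1 : ℤ) : ℝ) := by
    rw [CircleDeg1Lift.translationNumber_pow, hρ, mul_div_cancel₀ _ hq']
  have hcont : Continuous (trapLift r t ^ (m + m)) := by
    rw [CircleDeg1Lift.coe_pow]; exact (continuous_trapLift r t).iterate _
  rcases lt_trichotomy t t₁ with hlt | heq | hgt
  · have := CircleDeg1Lift.translationNumber_lt_of_forall_lt_add _ hcont
      (z := ((2 * j + 1 : ℤ) : ℝ)) fun x => by
        rw [CircleDeg1Lift.coe_pow, ← hall x]
        exact iterate_lt_iterate_of_lt r hlt hq x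
    exact absurd hpow this.ne
  · exact heq
  · have := CircleDeg1Lift.lt_translationNumber_of_forall_add_lt _ hcont
      (z := ((2 * j + 1 : ℤ) : ℝ)) fun x => by
        rw [CircleDeg1Lift.coe_pow, ← hall x]
        exact iterate_lt_iterate_of_lt r hgt hq x
    exact absurd hpow this.ne'

end Base

/-- A pair of rationals with odd denominators which are Farey neighbours around `x`. -/
structure IsOddFareyPair (x : ℝ) (p₁ q₁ p₂ q₂ : ℤ) : Prop where
  pos_left : 0 < q₁
  pos_right : 0 < q₂
  odd_left : Odd q₁
  odd_right : Odd q₂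
  det : p₂ * q₁ - p₁ * q₂ = 1
  lt_left : (p₁ : ℝ) < q₁ * x
  lt_right : (q₂ : ℝ) * x < p₂

namespace IsOddFareyPair

variable {x : ℝ} {p₁ q₁ p₂ q₂ : ℤ}

lemma neg (h : IsOddFareyPair x p₁ q₁ p₂ q₂) : IsOddFareyPair (-x) (-p₂) q₂ (-p₁) q₁ where
  pos_left := h.pos_right
  pos_right := h.pos_left
  odd_left := h.odd_right
  odd_right := h.odd_left
  det := by linear_combination h.det
  lt_left := by push_cast; linarith [h.lt_right]
  lt_right := by push_cast; linarith [h.lt_left]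

lemma intCast_mul_ne (hx : Irrational x) {q : ℤ} (hq : q ≠ 0) (p : ℤ) : (q : ℝ) * x ≠ p :=
  (hx.intCast_mul hq).ne_int p

lemma exists_larger_of_lt (hx : Irrational x) (h : IsOddFareyPair x p₁ q₁ p₂ q₂)
    (hlt : p₂ - q₂ * x < q₁ * x - p₁) :
    ∃ p₁' q₁' p₂' q₂', IsOddFareyPair x p₁' q₁' p₂' q₂' ∧ q₁ + q₂ < q₁' + q₂' := by
  obtain ⟨p1, p2, o1, o2, hd, l1, l2⟩ := h
  have hex : ∃ k : ℕ, (0 : ℝ) < k * (q₁ * x - p₁) - (k + 1) * (p₂ - q₂ * x) := by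
    obtain ⟨k, hk⟩ := Archimedean.arch (p₂ - q₂ * x) (sub_pos.2 hlt)
    refine ⟨k + 1, ?_⟩
    rw [nsmul_eq_mul] at hk
    push_cast
    linarith
  classical
  obtain ⟨k, hk, hmin⟩ : ∃ k : ℕ, (0 : ℝ) < k * (q₁ * x - p₁) - (k + 1) * (p₂ - q₂ * x) ∧
      ∀ l < k, ¬ (0 : ℝ) < l * (q₁ * x - p₁) - (l + 1) * (p₂ - q₂ * x) :=
    ⟨Nat.find hex, Nat.find_spec hex, fun l hl => Nat.find_min hex hl⟩
  obtain ⟨l, rfl⟩ : ∃ l, k = l + 1 := by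
    refine Nat.exists_eq_succ_of_ne_zero fun h0 => ?_
    rw [h0] at hk
    push_cast at hk
    linarith
  have hl := not_lt.1 (hmin l l.lt_succ_self)
  obtain ⟨a, ha⟩ := o1
  obtain ⟨b, hb⟩ := o2
  have hl0 : (0 : ℤ) ≤ l := Int.natCast_nonneg l
  have m1 := mul_nonneg hl0 p1.le
  have m2 := mul_nonneg hl0 p2.le
  have hne := intCast_mul_ne hx (q := l * q₁ + (l + 1) * q₂) (by linarith)
    (l * p₁ + (l + 1) * p₂)
  refine ⟨(l + 1) * p₁ + (l + 2) * p₂, (l + 1) * q₁ + (l + 2) * q₂, l * p₁ + (l + 1) * p₂,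
    l * q₁ + (l + 1) * q₂, ⟨by linarith, by linarith, ?_, ?_, ?_, ?_, ?_⟩, by linarith⟩
  · exact ⟨(l + 1) * a + (l + 2) * b + l + 1, by rw [ha, hb]; ring⟩
  · exact ⟨l * a + (l + 1) * b + l, by rw [ha, hb]; ring⟩
  · linear_combination hd
  · push_cast at hk ⊢
    linarith
  · refine lt_of_le_of_ne ?_ hne
    push_cast
    linarith

lemma exists_larger (hx : Irrational x) (h : IsOddFareyPair x p₁ q₁ p₂ q₂) :
    ∃ p₁' q₁' p₂' q₂', IsOddFareyPair x p₁' q₁' p₂' q₂' ∧ q₁ + q₂ < q₁' + q₂' := by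
  rcases lt_trichotomy (p₂ - q₂ * x) (q₁ * x - p₁) with hlt | heq | hgt
  · exact h.exists_larger_of_lt hx hlt
  · have := h.pos_left
    have := h.pos_right
    refine absurd ?_ (intCast_mul_ne hx (q := q₁ + q₂) (by omega) (p₁ + p₂))
    push_cast
    linarith
  · obtain ⟨a, b, c, d, h', hlt⟩ := h.neg.exists_larger_of_lt hx.neg (by push_cast; linarith)
    exact ⟨-c, d, -a, b, by simpa using h'.neg, by linarith⟩

lemma exists_le_add (hx : Irrational x) (n : ℕ) :
    ∃ p₁ q₁ p₂ q₂, IsOddFareyPair x p₁ q₁ p₂ q₂ ∧ (n : ℤ) ≤ q₁ + q₂ := by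
  induction n with
  | zero =>
    refine ⟨⌊x⌋, 1, ⌊x⌋ + 1, 1, ⟨one_pos, one_pos, odd_one, odd_one, by ring, ?_, ?_⟩, by simp⟩
    · rw [Int.cast_one, one_mul]
      exact lt_of_le_of_ne (Int.floor_le x) (hx.ne_int _).symm
    · push_cast
      rw [one_mul]
      exact Int.lt_floor_add_one x
  | succ n ih =>
    obtain ⟨p₁, q₁, p₂, q₂, h, hn⟩ := ih
    obtain ⟨p₁', q₁', p₂', q₂', h', hlt⟩ := h.exists_larger hx
    exact ⟨p₁', q₁', p₂', q₂', h', by push_cast; omega⟩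

lemma mul_lt_half_or (hx : Irrational x) (h : IsOddFareyPair x p₁ q₁ p₂ q₂) :
    q₁ * (q₁ * x - p₁) < 1 / 2 ∨ q₂ * (p₂ - q₂ * x) < 1 / 2 := by
  by_contra! hcon
  have h1 : (0 : ℝ) < q₁ := by exact_mod_cast h.pos_left
  have h2 : (0 : ℝ) < q₂ := by exact_mod_cast h.pos_right
  have hd : (p₂ : ℝ) * q₁ - p₁ * q₂ = 1 := by exact_mod_cast h.det
  have hlt : 1 / 2 < q₁ * (q₁ * x - p₁) := by
    refine lt_of_le_of_ne hcon.1 fun heq => ?_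
    have := h.pos_left
    refine intCast_mul_ne hx (q := 2 * (q₁ * q₁)) (by positivity) (1 + 2 * q₁ * p₁) ?_
    push_cast
    linarith
  have e : (q₁ : ℝ) * q₂ = q₂ ^ 2 * (q₁ * (q₁ * x - p₁)) + q₁ ^ 2 * (q₂ * (p₂ - q₂ * x)) := by
    linear_combination -(q₁ * q₂ : ℝ) * hd
  have g1 := mul_lt_mul_of_pos_left hlt (pow_pos h2 2)
  have g2 := mul_le_mul_of_nonneg_left hcon.2 (pow_pos h1 2).le
  nlinarith [sq_nonneg ((q₁ : ℝ) - q₂)]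

end IsOddFareyPair

/-- The fractions `p / q` in lowest terms with odd denominator that approximate `x` well. -/
def oddApprox (x : ℝ) : Set (ℤ × ℕ) :=
  {v | Odd v.2 ∧ IsCoprime v.1 v.2 ∧ |x - v.1 / v.2| < 1 / (2 * v.2 ^ 2)}

lemma mk_mem_oddApprox {x : ℝ} {p q : ℤ} (hq : 0 < q) (hodd : Odd q) (hpq : IsCoprime p q)
    (h : q * |q * x - p| < 1 / 2) : (p, q.toNat) ∈ oddApprox x := by
  lift q to ℕ using hq.le
  have hq' : (0 : ℝ) < q := by exact_mod_cast hq
  refine ⟨by exact_mod_cast hodd, hpq, ?_⟩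
  simp only [Int.toNat_natCast, Int.cast_natCast] at h ⊢
  rw [show x - p / q = (q * x - p) / q by field_simp, abs_div, abs_of_pos hq', div_lt_div_iff₀ hq'
    (by positivity)]
  nlinarith

lemma exists_mem_oddApprox {x : ℝ} (hx : Irrational x) (n : ℕ) :
    ∃ v ∈ oddApprox x, (n : ℝ) * |v.2 * x - v.1| ≤ 1 := by
  obtain ⟨p₁, q₁, p₂, q₂, h, hn⟩ := IsOddFareyPair.exists_le_add hx (2 * n)
  have h1 : (0 : ℝ) < q₁ := by exact_mod_cast h.pos_left
  have h2 : (0 : ℝ) < q₂ := by exact_mod_cast h.pos_right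
  have hd : (p₂ : ℝ) * q₁ - p₁ * q₂ = 1 := by exact_mod_cast h.det
  have hn' : (2 * n : ℝ) ≤ q₁ + q₂ := by exact_mod_cast hn
  have e1 : 0 < q₁ * x - p₁ := sub_pos.2 h.lt_left
  have e2 : 0 < p₂ - q₂ * x := sub_pos.2 h.lt_right
  have m1 := mul_pos h2 e1
  have m2 := mul_pos h1 e2
  have hsum : q₂ * (q₁ * x - p₁) + q₁ * (p₂ - q₂ * x) = 1 := by linear_combination hd
  rcases h.mul_lt_half_or hx with hg | hg
  · refine ⟨_, mk_mem_oddApprox (p := p₁) h.pos_left h.odd_left ⟨-q₂, p₂, by linear_combination h.det⟩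
      (by rwa [abs_of_pos e1]), ?_⟩
    have hc : ((q₁.toNat : ℕ) : ℝ) = q₁ := by
      exact_mod_cast Int.toNat_of_nonneg h.pos_left.le
    simp only [hc]
    rw [abs_of_pos e1]
    nlinarith
  · refine ⟨_, mk_mem_oddApprox (p := p₂) h.pos_right h.odd_right ⟨q₁, -p₁, by linear_combination h.det⟩
      (by rwa [abs_of_neg (by linarith), neg_sub]), ?_⟩
    have hc : ((q₂.toNat : ℕ) : ℝ) = q₂ := by
      exact_mod_cast Int.toNat_of_nonneg h.pos_right.le
    simp only [hc]
    rw [abs_of_neg (by linarith), neg_sub]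
    nlinarith

lemma infinite_oddApprox {x : ℝ} (hx : Irrational x) : (oddApprox x).Infinite := by
  intro hfin
  obtain ⟨v₀, h₀, -⟩ := exists_mem_oddApprox hx 0
  obtain ⟨v, hv, hmin⟩ := Set.exists_min_image (oddApprox x) (fun v => |v.2 * x - v.1|) hfin
    ⟨v₀, h₀⟩
  have hpos : 0 < |v.2 * x - v.1| := by
    refine abs_pos.2 (sub_ne_zero.2 ?_)
    exact_mod_cast IsOddFareyPair.intCast_mul_ne hx (q := v.2) (by exact_mod_cast hv.1.pos.ne') v.1
  obtain ⟨n, hn⟩ := Archimedean.arch 2 hpos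
  obtain ⟨w, hw, hle⟩ := exists_mem_oddApprox hx n
  rw [nsmul_eq_mul] at hn
  have := mul_le_mul_of_nonneg_left (hmin w hw) (Nat.cast_nonneg (α := ℝ) n)
  linarith

section NullSet

variable (r : Ioo (0 : ℝ) 1)

lemma rotation_intCast (k : ℤ) : ρ (trapLift r k) = k := by
  have hB : bpt r 1 = 1 / 2 := by have := bpt_odd r 0; norm_num at this ⊢; exact this
  have h := rotation_eq_of_iterate_eq r (t := k) (x := bpt r 1) (q := 1) (p := k) one_pos (by
    rw [Function.iterate_one, trapLift_apply, baseLift_bpt, bpt_neg, hB]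
    push_cast
    ring)
  rw [h, Nat.cast_one, div_one]

lemma rotation_mono {t t' : ℝ} (h : t ≤ t') : ρ (trapLift r t) ≤ ρ (trapLift r t') :=
  CircleDeg1Lift.translationNumber_mono (trapLift_mono r h)

lemma volume_setOf_irrational_rotation :
    MeasureTheory.volume {t | t ∈ Icc (0 : ℝ) 1 ∧ Irrational (ρ (trapLift r t))} = 0 := by
  set J : Set (ℤ × ℕ) := {v | Odd v.2 ∧ IsCoprime v.1 v.2 ∧
    (v.1 : ℝ) / v.2 ∈ Ioo ((-1 : ℤ) : ℝ) ((2 : ℤ) : ℝ)} with hJ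
  have hex₁ : ∀ v : J, ∃ t, (trapLift r t)^[v.1.2] (bpt r 0) = bpt r 0 + v.1.1 := fun v =>
    exists_iterate_eq_add_int r v.2.1.pos _ _
  have hex₂ : ∀ v : J, ∃ t, (trapLift r t)^[v.1.2] (bpt r 1) = bpt r 1 + v.1.1 := fun v =>
    exists_iterate_eq_add_int r v.2.1.pos _ _
  choose t₁ h₁ using hex₁
  choose t₂ h₂ using hex₂
  have hρ₁ : ∀ v : J, ρ (trapLift r (t₁ v)) = v.1.1 / v.1.2 := fun v =>
    rotation_eq_of_iterate_eq r v.2.1.pos (h₁ v)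
  have hρ₂ : ∀ v : J, ρ (trapLift r (t₂ v)) = v.1.1 / v.1.2 := fun v =>
    rotation_eq_of_iterate_eq r v.2.1.pos (h₂ v)
  have hρ : ∀ v : J, ∀ t ∈ Icc (t₁ v) (t₂ v), ρ (trapLift r t) = v.1.1 / v.1.2 :=
    fun v t ht => le_antisymm ((rotation_mono r ht.2).trans_eq (hρ₂ v))
      ((hρ₁ v).symm.trans_le (rotation_mono r ht.1))
  have hle : ∀ v : J, t₁ v ≤ t₂ v := fun v => tongue_le r v.2.1 v.2.2.1 (h₁ v) (h₂ v)
  have hdisj : Pairwise (Function.onFun Disjoint fun v : J => Icc (t₁ v) (t₂ v)) := by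
    refine fun v w hvw => Set.disjoint_left.2 fun t htv htw => hvw ?_
    have heq := (hρ v t htv).symm.trans (hρ w t htw)
    have hinj := Rat.div_int_inj (a := v.1.1) (b := v.1.2) (c := w.1.1) (d := w.1.2)
      (by exact_mod_cast v.2.1.pos) (by exact_mod_cast w.2.1.pos)
      (by exact Int.isCoprime_iff_gcd_eq_one.1 v.2.2.1)
      (by exact Int.isCoprime_iff_gcd_eq_one.1 w.2.2.1) (by
        have : (((v.1.1 : ℚ) / v.1.2 : ℚ) : ℝ) = ((w.1.1 : ℚ) / w.1.2 : ℚ) := by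
          push_cast; exact heq
        exact_mod_cast this)
    exact Subtype.ext (Prod.ext hinj.1 (by exact_mod_cast hinj.2))
  have hsub : (⋃ v : J, Icc (t₁ v) (t₂ v)) ⊆ Icc ((-1 : ℤ) : ℝ) ((2 : ℤ) : ℝ) := by
    refine iUnion_subset fun v t ht => ⟨?_, ?_⟩ <;> by_contra! hlt <;>
      have := rotation_mono r hlt.le <;>
      rw [rotation_intCast, hρ v t ht] at this
    · exact this.not_gt v.2.2.2.1
    · exact this.not_gt v.2.2.2.2
  have hsum : ∑' v : J, MeasureTheory.volume (Icc (t₁ v) (t₂ v)) ≠ ⊤ := by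
    rw [← MeasureTheory.measure_iUnion hdisj fun v => measurableSet_Icc]
    refine ((MeasureTheory.measure_mono hsub).trans_lt ?_).ne
    rw [Real.volume_Icc]
    exact ENNReal.ofReal_lt_top
  set U : J → Set ℝ := fun v => Icc (t₂ v - tongueConst r * (t₂ v - t₁ v))
    (t₁ v + tongueConst r * (t₂ v - t₁ v)) with hU
  have hsumU : ∑' v : J, MeasureTheory.volume (U v) ≠ ⊤ := by
    refine ne_top_of_le_ne_top (ENNReal.mul_ne_top (ENNReal.ofReal_ne_top
      (r := 2 * tongueConst r)) hsum) ?_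
    rw [← ENNReal.tsum_mul_left]
    refine ENNReal.tsum_le_tsum fun v => ?_
    rw [Real.volume_Icc, Real.volume_Icc, ← ENNReal.ofReal_mul
      (by have := tongueConst_pos r; positivity)]
    refine ENNReal.ofReal_le_ofReal ?_
    linarith [hle v]
  have hae := MeasureTheory.ae_finite_setOfPred_mem hsumU
  refine MeasureTheory.measure_mono_null ?_ hae
  rintro t ⟨ht, hirr⟩ hfin
  have h0 := rotation_mono r ht.1
  have h1 := rotation_mono r ht.2
  have e0 := rotation_intCast r 0
  have e1 := rotation_intCast r 1
  rw [Int.cast_zero] at e0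
  rw [Int.cast_one] at e1
  refine infinite_oddApprox hirr ((hfin.image Subtype.val).subset fun v hv => ?_)
  have hvJ : v ∈ J := by
    refine ⟨hv.1, hv.2.1, ?_⟩
    have hq : (1 : ℝ) ≤ v.2 := by exact_mod_cast hv.1.pos
    have hlt : |ρ (trapLift r t) - v.1 / v.2| < 1 := hv.2.2.trans_le (by
      rw [div_le_one (by positivity)]
      nlinarith)
    rw [abs_lt] at hlt
    push_cast
    constructor <;> linarith
  refine ⟨⟨v, hvJ⟩, ?_, rfl⟩
  refine mem_Icc_of_rotation_near r hv.1 hv.2.1 (h₁ ⟨v, hvJ⟩) (h₂ ⟨v, hvJ⟩) ?_ hv.2.2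
  exact_mod_cast hirr.ne_rat (v.1 / v.2)

/-- The nonnegative rationals with odd denominator. -/
def oddRat : Set ℝ := {x | ∃ p q : ℕ, Nat.Coprime p q ∧ Odd q ∧ x = (p : ℝ) / (q : ℝ)}

lemma countable_oddRat : oddRat.Countable := by
  refine (Set.countable_range fun v : ℕ × ℕ => (v.1 : ℝ) / v.2).mono ?_
  rintro x ⟨p, q, -, -, rfl⟩
  exact ⟨(p, q), rfl⟩

lemma subsingleton_setOf_rotation_eq {s : ℚ} (hs : Even s.den) :
    {t | ρ (trapLift r t) = s}.Subsingleton := by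
  have hodd : Odd s.num := by
    rw [← Int.natAbs_odd, ← Nat.not_even_iff_odd]
    intro h
    have := Nat.dvd_gcd h.two_dvd hs.two_dvd
    rw [s.reduced] at this
    omega
  obtain ⟨t₁, h₁⟩ := exists_iterate_eq_add_int r s.den_pos s.num (bpt r 0)
  have hs' : (s : ℝ) = s.num / s.den := Rat.cast_def s
  intro t ht t' ht'
  rw [mem_ofPred_eq, hs'] at ht ht'
  rw [eq_of_rotation_eq_of_even r s.den_pos hs hodd h₁ ht,
    eq_of_rotation_eq_of_even r s.den_pos hs hodd h₁ ht']

lemma volume_setOf_rotation_notMem_oddRat :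
    MeasureTheory.volume {t | t ∈ Icc (0 : ℝ) 1 ∧ ρ (trapLift r t) ∉ oddRat} = 0 := by
  have hcount : (⋃ s ∈ {s : ℚ | Even s.den}, {t | ρ (trapLift r t) = s}).Countable :=
    (Set.to_countable _).biUnion fun s hs => (subsingleton_setOf_rotation_eq r hs).countable
  refine MeasureTheory.measure_mono_null ?_ (MeasureTheory.measure_union_null
    (volume_setOf_irrational_rotation r) (hcount.measure_zero MeasureTheory.volume))
  rintro t ⟨ht, hnot⟩
  by_cases hirr : Irrational (ρ (trapLift r t))
  · exact Or.inl ⟨ht, hirr⟩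
  · right
    obtain ⟨s, hs⟩ := not_not.1 hirr
    refine mem_iUnion₂.2 ⟨s, ?_, hs.symm⟩
    by_contra hodd
    have hodd' : Odd s.den := Nat.not_even_iff_odd.1 hodd
    have h0 := rotation_mono r ht.1
    have e0 := rotation_intCast r 0
    rw [Int.cast_zero] at e0
    rw [e0, ← hs] at h0
    have hnum : 0 ≤ s.num := Rat.num_nonneg.2 (by exact_mod_cast h0)
    refine hnot ⟨s.num.natAbs, s.den, s.reduced, hodd', ?_⟩
    rw [← hs, Rat.cast_def, Nat.cast_natAbs, abs_of_nonneg hnum]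

end NullSet

/-! ### Reduction of the trapezoid map to the normalized family -/

/-- Null exceptional set in the normalized parameter plane. -/
def normalizedBad : Set (ℝ × ℝ) :=
  {z | (z.1 ∈ Ioo (0 : ℝ) 1 ∧ z.2 ∈ Icc (0 : ℝ) 1) ∧ ¬ ∃ L ∈ oddRat,
    Tendsto (fun n : ℕ => (fun x => baseLift z.1 x + z.2)^[n] 0 / (n : ℝ)) atTop (nhds L)}

lemma measurable_iterate_baseLift (n : ℕ) :
    Measurable fun z : ℝ × ℝ => (fun x => baseLift z.1 x + z.2)^[n] 0 := by
  induction n with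
  | zero => exact measurable_const
  | succ n ih =>
    simp only [Function.iterate_succ_apply']
    exact (measurable_baseLift.comp (measurable_fst.prodMk ih)).add measurable_snd

lemma measurableSet_normalizedBad : MeasurableSet normalizedBad := by
  have h : MeasurableSet (⋃ L ∈ oddRat, {z : ℝ × ℝ | Tendsto
      (fun n : ℕ => (fun x => baseLift z.1 x + z.2)^[n] 0 / (n : ℝ)) atTop (nhds L)}) :=
    MeasurableSet.biUnion countable_oddRat fun L _ =>
      measurableSet_tendsto (nhds L) fun n => (measurable_iterate_baseLift n).div_const _
  convert ((measurableSet_Ioo (a := (0 : ℝ)) (b := 1)).prod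
    (measurableSet_Icc (a := (0 : ℝ)) (b := 1))).inter h.compl using 1
  ext z
  simp [normalizedBad]

lemma tendsto_iterate_baseLift_div (r : Ioo (0 : ℝ) 1) (t x c : ℝ) :
    Tendsto (fun n : ℕ => ((fun x => baseLift r x + t)^[n] x - c) / (n : ℝ)) atTop
      (nhds (ρ (trapLift r t))) := by
  have h := ((trapLift r t).tendsto_translationNumber x).add
    (tendsto_const_div_atTop_nhds_zero_nat (x - c))
  rw [add_zero] at h
  refine h.congr fun n => ?_
  rw [← add_div, CircleDeg1Lift.coe_pow, sub_add_sub_cancel]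
  rfl

lemma volume_normalizedBad : MeasureTheory.volume normalizedBad = 0 := by
  rw [MeasureTheory.Measure.volume_eq_prod,
    MeasureTheory.Measure.measure_prod_null measurableSet_normalizedBad]
  refine Eventually.of_forall fun r => ?_
  by_cases hr : r ∈ Ioo (0 : ℝ) 1
  · refine MeasureTheory.measure_mono_null ?_ (volume_setOf_rotation_notMem_oddRat ⟨r, hr⟩)
    rintro t ⟨⟨-, ht⟩, hnot⟩
    refine ⟨ht, fun hmem => hnot ⟨_, hmem, ?_⟩⟩
    simpa using tendsto_iterate_baseLift_div ⟨r, hr⟩ t 0 0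
  · change MeasureTheory.volume (Prod.mk r ⁻¹' normalizedBad) = 0
    rw [eq_empty_of_forall_notMem (s := Prod.mk r ⁻¹' normalizedBad) fun t ht => hr ht.1.1,
      MeasureTheory.measure_empty]

/-- The trapezoid angles `(α, θ)` with normalized parameters `z`. -/
noncomputable def trapAngles (ℓ : ℝ) (z : ℝ × ℝ) : ℝ × ℝ :=
  (arctan (2 * ℓ * z.1 / z.2), arctan (2 * ℓ / z.2))

lemma volume_image_trapAngles (ℓ : ℝ) :
    MeasureTheory.volume (trapAngles ℓ '' (normalizedBad ∩ {z | 0 < z.2})) = 0 := by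
  refine MeasureTheory.addHaar_image_eq_zero_of_differentiableOn_of_addHaar_eq_zero _ ?_
    (MeasureTheory.measure_mono_null inter_subset_left volume_normalizedBad)
  rintro z ⟨-, hz⟩
  have hz' : z.2 ≠ 0 := ne_of_gt hz
  refine DifferentiableAt.differentiableWithinAt (DifferentiableAt.prodMk ?_ ?_)
  · exact DifferentiableAt.arctan (by fun_prop (disch := assumption))
  · exact DifferentiableAt.arctan (by fun_prop (disch := assumption))

lemma Lam_eq {α θ : ℝ} (hα : cos α ≠ 0) (hθ : cos θ ≠ 0) :
    Lam α θ = (tan θ + tan α) / (tan θ - tan α) := by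
  have h₁ : sin (θ + α) = (tan θ + tan α) * (cos θ * cos α) := by
    rw [sin_add, tan_eq_sin_div_cos, tan_eq_sin_div_cos]
    field_simp
  have h₂ : sin (θ - α) = (tan θ - tan α) * (cos θ * cos α) := by
    rw [sin_sub, tan_eq_sin_div_cos, tan_eq_sin_div_cos]
    field_simp
  rw [Lam, h₁, h₂, mul_div_mul_right _ _ (mul_ne_zero hθ hα)]

lemma Ftrap_eq {ℓ α θ : ℝ} (hα : cos α ≠ 0) (hθ : cos θ ≠ 0) (hT : 0 < tan θ) (x : ℝ) :
    Ftrap ℓ α θ x = baseLift (tan α / tan θ) (x + ℓ / tan θ) + ℓ / tan θ := by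
  have hΛ : Lam α θ = (1 + tan α / tan θ) / (1 - tan α / tan θ) := by
    rw [Lam_eq hα hθ, ← mul_div_mul_right (1 + tan α / tan θ) _ hT.ne', add_mul, sub_mul,
      div_mul_cancel₀ _ hT.ne', one_mul]
  have h0 : brk0 ℓ θ = 1 / 2 - ℓ / tan θ := by
    rw [brk0]; field_simp
  have h1 : brk1 ℓ α θ = -(ℓ / tan θ) - tan α / tan θ / 2 := by
    rw [brk1]; field_simp; ring
  rw [Ftrap, Ftrap0, hΛ, h0, h1, baseLift, inv_div]
  generalize tan α / tan θ = r
  generalize ℓ / tan θ = s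
  have hfl : x - (-s - r / 2) = x + s + r / 2 := by ring
  rw [hfl]
  generalize ((⌊x + s + r / 2⌋ : ℤ) : ℝ) = m
  by_cases h : x - m ≤ 1 / 2 - s
  · rw [if_pos h, if_pos (by linarith)]
    ring
  · rw [if_neg h, if_neg (by linarith)]
    ring

lemma iterate_Ftrap {ℓ α θ : ℝ} (hα : cos α ≠ 0) (hθ : cos θ ≠ 0) (hT : 0 < tan θ) (n : ℕ)
    (x : ℝ) : (Ftrap ℓ α θ)^[n] x =
      (fun y => baseLift (tan α / tan θ) y + 2 * ℓ / tan θ)^[n] (x + ℓ / tan θ) - ℓ / tan θ := by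
  have h : Function.Semiconj (· + ℓ / tan θ) (Ftrap ℓ α θ)
      fun y => baseLift (tan α / tan θ) y + 2 * ℓ / tan θ := fun y => by
    simp only [Ftrap_eq hα hθ hT]
    ring
  rw [eq_sub_iff_add_eq]
  exact (h.iterate_right n) x

lemma rotationNumber_Ftrap {ℓ α θ : ℝ} (hα : cos α ≠ 0) (hθ : cos θ ≠ 0) (hT : 0 < tan θ)
    (hr : tan α / tan θ ∈ Ioo (0 : ℝ) 1) :
    rotationNumber (Ftrap ℓ α θ) = ρ (trapLift ⟨tan α / tan θ, hr⟩ (2 * ℓ / tan θ)) := by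
  refine Tendsto.limUnder_eq ?_
  simp only [iterate_Ftrap hα hθ hT]
  exact tendsto_iterate_baseLift_div ⟨tan α / tan θ, hr⟩ _ _ _

/-- for every ℓ > 0 and Lebesgue-a.e. admissible (α, θ), the
rotation number ρ(F_{ℓ,α,θ}) equals p/q with p, q coprime nonnegative
integers and q odd. -/
theorem stmt10 (ℓ : ℝ) (hℓ : 0 < ℓ) :
    MeasureTheory.volume {pa : ℝ × ℝ |
      (0 < pa.1 ∧ pa.1 < pa.2 ∧ pa.2 < π / 2 ∧
        Real.tan pa.2 > 2 * ℓ + Real.tan pa.1) ∧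
      ¬ ∃ (p q : ℕ), Nat.Coprime p q ∧ Odd q ∧
          rotationNumber (Ftrap ℓ pa.1 pa.2) = (p : ℝ) / (q : ℝ)} = 0 := by
  refine MeasureTheory.measure_mono_null ?_ (volume_image_trapAngles ℓ)
  rintro ⟨α, θ⟩ ⟨⟨h0, h1, h2, h3⟩, hnot⟩
  dsimp only at h0 h1 h2 h3 hnot
  have hα : cos α ≠ 0 := (cos_pos_of_mem_Ioo ⟨by linarith, by linarith⟩).ne'
  have hθ : cos θ ≠ 0 := (cos_pos_of_mem_Ioo ⟨by linarith, h2⟩).ne'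
  have ha : 0 < tan α := tan_pos_of_pos_of_lt_pi_div_two h0 (by linarith)
  have hT : 0 < tan θ := tan_pos_of_pos_of_lt_pi_div_two (by linarith) h2
  have hr : tan α / tan θ ∈ Ioo (0 : ℝ) 1 :=
    ⟨div_pos ha hT, (div_lt_one hT).2 (by linarith)⟩
  have ht : 0 < 2 * ℓ / tan θ := by positivity
  have ht1 : 2 * ℓ / tan θ ≤ 1 := (div_le_one hT).2 (by linarith)
  refine ⟨(tan α / tan θ, 2 * ℓ / tan θ), ⟨⟨⟨hr, ht.le, ht1⟩, ?_⟩, ht⟩, ?_⟩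
  · rintro ⟨L, hL, hlim⟩
    have hρ := rotationNumber_Ftrap (ℓ := ℓ) hα hθ hT hr
    have hlim' := tendsto_iterate_baseLift_div ⟨tan α / tan θ, hr⟩ (2 * ℓ / tan θ) 0 0
    simp only [sub_zero] at hlim'
    rw [tendsto_nhds_unique hlim' hlim] at hρ
    obtain ⟨p, q, hpq, hq, rfl⟩ := hL
    exact hnot ⟨p, q, hpq, hq, hρ⟩
  · have e1 : 2 * ℓ * (tan α / tan θ) / (2 * ℓ / tan θ) = tan α := by field_simp
    have e2 : 2 * ℓ / (2 * ℓ / tan θ) = tan θ := by field_simp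
    simp only [trapAngles, e1, e2]
    rw [arctan_tan (by linarith) (by linarith), arctan_tan (by linarith) h2]
end

section
/- Fix m ∈ [1/2, 1) and let A = [[1, 1], [0, 1]] and B = [[1, 0], [1/(m − m²), 1]] in SL(2,ℝ). Let M = [[a, b], [c, d]] be any finite product of matrices from {A, A⁻¹, B, B⁻¹}, and let s ∈ ℝ satisfy cs + d ≠ 0; set s' := (as + b)/(cs + d). Then the circle map g_{m,s} has a periodic point (i.e., there exist x ∈ ℝ, an integer n ≥ 1 and k ∈ ℤ with G_{m,s}ⁿ(x) = x + k) if, and only if, g_{m,s'} has a periodic point. -/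
open Real Filter Set

/-- The two-piece definition of the dilation-torus lift on `[0,1)`. -/
noncomputable def Gdil0 (m s x : ℝ) : ℝ :=
  if x ≤ 1 - m then s + 1 - m + (m / (1 - m)) * x
  else s + 1 + ((1 - m) / m) * (x - (1 - m))

/-- The lift `G_{m,s} : ℝ → ℝ` of the Poincaré map of the linear flow of
direction `arctan(1/s)` on the dilation torus: given by the two-piece formula
on `[0,1)` and extended by `G(x+k) = G(x)+k` for `k ∈ ℤ`. -/
noncomputable def Gdil (m s x : ℝ) : ℝ :=
  Gdil0 m s (x - ⌊x⌋) + ⌊x⌋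

open scoped Matrix

/-- A transitive relation on `ℝ` that holds between the points of each unit interval `[j, j + 1]`
holds between any two points. -/
theorem rel_of_rel_on_unit_intervals (r : ℝ → ℝ → Prop)
    (htrans : ∀ a b c, r a b → r b c → r a c) {a b : ℝ} (hab : a < b)
    (h : ∀ (j : ℤ) (x y : ℝ), a ≤ x → x < y → y ≤ b → (j : ℝ) ≤ x → y ≤ j + 1 → r x y) :
    r a b := by
  have key : ∀ (n : ℕ) (x : ℝ), a ≤ x → x < b → b ≤ ⌊x⌋ + 1 + n → r x b := by
    intro n
    induction n with
    | zero =>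
      intro x hx hxb hb
      exact h ⌊x⌋ x b hx hxb le_rfl (Int.floor_le x) (by simpa using hb)
    | succ n ih =>
      intro x hx hxb hb
      by_cases hle : b ≤ ⌊x⌋ + 1
      · exact h ⌊x⌋ x b hx hxb le_rfl (Int.floor_le x) hle
      · push Not at hle
        have hlt : x < ⌊x⌋ + 1 := Int.lt_floor_add_one x
        refine htrans _ _ _ (h ⌊x⌋ x (⌊x⌋ + 1) hx hlt hle.le (Int.floor_le x) le_rfl)
          (ih _ (hx.trans hlt.le) hle ?_)
        push_cast at hb
        simp only [Int.floor_add_one, Int.floor_intCast]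
        push_cast
        linarith
  obtain ⟨n, hn⟩ := exists_nat_ge (b - a)
  refine key n a le_rfl hab ?_
  have := Int.lt_floor_add_one a
  linarith

/-- The lengths of the intervals cut out on `ℝ` by the break points of `Gdil m s`. -/
noncomputable def tileWidth (m : ℝ) (n : ℤ) : ℝ := if Even n then 1 - m else m

/-- The break points of `Gdil m s`. -/
noncomputable def tileStart (m : ℝ) (n : ℤ) : ℝ := (n / 2 : ℤ) + if Even n then 0 else 1 - m

/-- The piecewise affine homeomorphism of `ℝ` sending the integers to the break points of
`Gdil m s`. It conjugates the translation by one to `Gdil m 0`. -/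
noncomputable def tileCoord (m u : ℝ) : ℝ := tileStart m ⌊u⌋ + tileWidth m ⌊u⌋ * (u - ⌊u⌋)

theorem tileStart_add_one (m : ℝ) (n : ℤ) :
    tileStart m (n + 1) = tileStart m n + tileWidth m n := by
  unfold tileStart tileWidth
  rcases Int.even_or_odd' n with ⟨k, rfl | rfl⟩
  · have h1 : (2 * k + 1) / 2 = k := by omega
    have h2 : ¬ Even (2 * k + 1) := by simp
    simp [h1, h2]
  · have h1 : (2 * k + 1 + 1) / 2 = k + 1 := by omega
    have h2 : ¬ Even (2 * k + 1) := by simp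
    have h3 : Even (2 * k + 1 + 1) := ⟨k + 1, by ring⟩
    have h4 : (2 * k + 1) / 2 = k := by omega
    simp only [h1, h2, h3, h4, if_true, if_false]
    push_cast
    ring

theorem tileCoord_eq (m : ℝ) (n : ℤ) {u : ℝ} (h0 : (n : ℝ) ≤ u) (h1 : u ≤ n + 1) :
    tileCoord m u = tileStart m n + tileWidth m n * (u - n) := by
  rcases h1.lt_or_eq with h | rfl
  · have : ⌊u⌋ = n := Int.floor_eq_iff.2 ⟨h0, h⟩
    rw [tileCoord, this]
  · simp [tileCoord, tileStart_add_one]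

theorem tileCoord_sub (m : ℝ) (n : ℤ) {u v : ℝ} (hu0 : (n : ℝ) ≤ u) (hu1 : u ≤ n + 1)
    (hv0 : (n : ℝ) ≤ v) (hv1 : v ≤ n + 1) :
    tileCoord m v - tileCoord m u = tileWidth m n * (v - u) := by
  rw [tileCoord_eq m n hu0 hu1, tileCoord_eq m n hv0 hv1]
  ring

theorem tileWidth_pos {m : ℝ} (hm : m ∈ Ioo (0 : ℝ) 1) (n : ℤ) : 0 < tileWidth m n := by
  unfold tileWidth
  split_ifs
  · linarith [hm.2]
  · exact hm.1

theorem tileWidth_mul_tileWidth (m : ℝ) (n : ℤ) :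
    tileWidth (1 - m) n * tileWidth m n = m * (1 - m) := by
  unfold tileWidth
  split_ifs <;> ring

theorem tileCoord_strictMono {m : ℝ} (hm : m ∈ Ioo (0 : ℝ) 1) : StrictMono (tileCoord m) := by
  intro a b hab
  refine rel_of_rel_on_unit_intervals (fun x y => tileCoord m x < tileCoord m y)
    (fun _ _ _ => lt_trans) hab ?_
  intro j x y _ hxy _ hj hj'
  have h := tileCoord_sub m j hj (hxy.le.trans hj') (hj.trans hxy.le) hj'
  have := mul_pos (tileWidth_pos hm j) (sub_pos.2 hxy)
  show tileCoord m x < tileCoord m y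
  linarith

theorem tileCoord_surjective {m : ℝ} (hm : m ∈ Ioo (0 : ℝ) 1) :
    Function.Surjective (tileCoord m) := by
  intro x
  have h0 : 0 < m := hm.1
  have h1 : 0 < 1 - m := by linarith [hm.2]
  have hf := Int.floor_le x
  have hf' := Int.lt_floor_add_one x
  by_cases h : x - ⌊x⌋ ≤ 1 - m
  · refine ⟨2 * ⌊x⌋ + (x - ⌊x⌋) / (1 - m), ?_⟩
    have h2 : 0 ≤ (x - ⌊x⌋) / (1 - m) := div_nonneg (by linarith) h1.le
    have h3 : (x - ⌊x⌋) / (1 - m) ≤ 1 := (div_le_one h1).2 h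
    rw [tileCoord_eq m (2 * ⌊x⌋) (by push_cast; linarith) (by push_cast; linarith)]
    simp only [tileStart, tileWidth, even_two_mul, if_true]
    rw [Int.mul_ediv_cancel_left _ two_ne_zero]
    push_cast
    field_simp
    ring
  · push Not at h
    refine ⟨2 * ⌊x⌋ + 1 + (x - ⌊x⌋ - (1 - m)) / m, ?_⟩
    have h2 : 0 ≤ (x - ⌊x⌋ - (1 - m)) / m := div_nonneg (by linarith) h0.le
    have h3 : (x - ⌊x⌋ - (1 - m)) / m ≤ 1 := (div_le_one h0).2 (by linarith)
    rw [tileCoord_eq m (2 * ⌊x⌋ + 1) (by push_cast; linarith) (by push_cast; linarith)]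
    have h4 : (2 * ⌊x⌋ + 1) / 2 = ⌊x⌋ := by omega
    have h5 : ¬ Even (2 * ⌊x⌋ + 1) := by simp
    simp only [tileStart, tileWidth, h4, h5, if_false]
    push_cast
    field_simp
    ring

theorem tileCoord_add_two_mul (m u : ℝ) (k : ℤ) :
    tileCoord m (u + 2 * k) = tileCoord m u + k := by
  have h1 : ⌊u + 2 * k⌋ = ⌊u⌋ + 2 * k := by exact_mod_cast Int.floor_add_intCast u (2 * k)
  have h2 : (⌊u⌋ + 2 * k) / 2 = ⌊u⌋ / 2 + k := by omega
  have h3 : Even (⌊u⌋ + 2 * k) ↔ Even ⌊u⌋ := by simp [Int.even_add]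
  simp only [tileCoord, tileStart, tileWidth, h1, h2, h3]
  push_cast
  ring

theorem tileCoord_one_sub (m u : ℝ) :
    tileCoord (1 - m) (u - 1) = tileCoord m u - (1 - m) := by
  have h1 : ⌊u - 1⌋ = ⌊u⌋ - 1 := Int.floor_sub_one u
  simp only [tileCoord, tileStart, tileWidth, h1]
  rcases Int.even_or_odd' ⌊u⌋ with ⟨k, hk | hk⟩ <;> rw [hk]
  · have h2 : (2 * k - 1) / 2 = k - 1 := by omega
    have h3 : ¬ Even (2 * k - 1) := by simp
    simp only [h2, h3, if_false, even_two_mul, if_true]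
    rw [Int.mul_ediv_cancel_left _ two_ne_zero]
    push_cast
    ring
  · have h2 : (2 * k + 1) / 2 = k := by omega
    have h3 : ¬ Even (2 * k + 1) := by simp
    simp only [h2, h3, if_false, add_sub_cancel_right, even_two_mul, if_true]
    rw [Int.mul_ediv_cancel_left _ two_ne_zero]
    push_cast
    ring

theorem Gdil_eq_add (m s x : ℝ) : Gdil m s x = Gdil m 0 x + s := by
  unfold Gdil Gdil0
  split_ifs <;> ring

theorem Gdil_add_intCast (m s x : ℝ) (k : ℤ) : Gdil m s (x + k) = Gdil m s x + k := by
  unfold Gdil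
  rw [Int.floor_add_intCast]
  push_cast
  rw [add_sub_add_right_eq_sub]
  ring

theorem Gdil_zero_tileCoord {m : ℝ} (hm : m ∈ Ioo (0 : ℝ) 1) (u : ℝ) :
    Gdil m 0 (tileCoord m u) = tileCoord m (u + 1) := by
  have h0 : 0 < m := hm.1
  have h1 : 0 < 1 - m := by linarith [hm.2]
  have hf := Int.floor_le u
  have hf' := Int.lt_floor_add_one u
  obtain ⟨r, hr⟩ : ∃ r : ℝ, r = u - ⌊u⌋ := ⟨_, rfl⟩
  have hr0 : 0 ≤ r := by linarith
  have hr1 : r < 1 := by linarith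
  rw [tileCoord_eq m (⌊u⌋ + 1) (u := u + 1) (by push_cast; linarith) (by push_cast; linarith),
    tileStart_add_one, tileCoord]
  have hu : u + 1 - ((⌊u⌋ + 1 : ℤ) : ℝ) = r := by push_cast; linarith
  rw [hu, ← hr]
  simp only [tileStart, tileWidth]
  rcases Int.even_or_odd' ⌊u⌋ with ⟨k, hk | hk⟩ <;> rw [hk]
  · have h3 : ¬ Even (2 * k + 1) := by simp
    simp only [h3, if_false, even_two_mul, if_true]
    rw [Int.mul_ediv_cancel_left _ two_ne_zero]
    have h4 : ⌊(k : ℝ) + 0 + (1 - m) * r⌋ = k :=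
      Int.floor_eq_iff.2 ⟨by nlinarith, by nlinarith⟩
    have h5 : (k : ℝ) + 0 + (1 - m) * r - k ≤ 1 - m := by nlinarith
    rw [Gdil, h4, Gdil0, if_pos h5]
    field_simp
    ring
  · have h2 : (2 * k + 1) / 2 = k := by omega
    have h3 : ¬ Even (2 * k + 1) := by simp
    have h3' : Even (2 * k + 1 + 1) := ⟨k + 1, by ring⟩
    simp only [h2, h3, h3', if_false, if_true]
    have h4 : ⌊(k : ℝ) + (1 - m) + m * r⌋ = k :=
      Int.floor_eq_iff.2 ⟨by nlinarith, by nlinarith⟩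
    rw [Gdil, h4, Gdil0]
    split_ifs with h5
    · have : r = 0 := le_antisymm (by nlinarith) hr0
      subst this
      field_simp
      ring
    · field_simp
      ring

theorem Gdil_zero_Gdil_zero {m : ℝ} (hm : m ∈ Ioo (0 : ℝ) 1) (x : ℝ) :
    Gdil m 0 (Gdil m 0 x) = x + 1 := by
  obtain ⟨u, rfl⟩ := tileCoord_surjective hm x
  rw [Gdil_zero_tileCoord hm, Gdil_zero_tileCoord hm]
  have := tileCoord_add_two_mul m u 1
  push_cast at this
  rw [← this]
  ring_nf

theorem Gdil_iterate_add_intCast (m s x : ℝ) (n : ℕ) (k : ℤ) :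
    (Gdil m s)^[n] (x + k) = (Gdil m s)^[n] x + k :=
  ((show Function.Commute (Gdil m s) (fun x => x + (k : ℝ)) from
    fun x => Gdil_add_intCast m s x k).iterate_left n) x

/-- The circle map with lift `Gdil m s` has a periodic point. -/
def HasPeriodicPoint (m s : ℝ) : Prop :=
  ∃ (x : ℝ) (n : ℕ) (k : ℤ), 1 ≤ n ∧ (Gdil m s)^[n] x = x + (k : ℝ)

theorem hasPeriodicPoint_zero {m : ℝ} (hm : m ∈ Ioo (0 : ℝ) 1) : HasPeriodicPoint m 0 :=
  ⟨0, 2, 1, by norm_num, by simp [Gdil_zero_Gdil_zero hm]⟩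

theorem HasPeriodicPoint.add_intCast {m s : ℝ} (h : HasPeriodicPoint m s) (l : ℤ) :
    HasPeriodicPoint m (s + l) := by
  obtain ⟨x, n, k, hn, hx⟩ := h
  have key : ∀ n : ℕ, (Gdil m (s + l))^[n] x = (Gdil m s)^[n] x + ((n * l : ℤ) : ℝ) := by
    intro n
    induction n with
    | zero => simp
    | succ n ih =>
      rw [Function.iterate_succ_apply', ih, Gdil_add_intCast, Function.iterate_succ_apply',
        Gdil_eq_add m (s + l), Gdil_eq_add m s]
      push_cast
      ring
  refine ⟨x, n, k + n * l, hn, ?_⟩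
  rw [key, hx]
  push_cast
  ring

theorem hasPeriodicPoint_add_one_iff {m s : ℝ} :
    HasPeriodicPoint m (s + 1) ↔ HasPeriodicPoint m s :=
  ⟨fun h => by simpa using h.add_intCast (-1), fun h => by simpa using h.add_intCast 1⟩

theorem HasPeriodicPoint.neg {m s : ℝ} (hm : m ∈ Ioo (0 : ℝ) 1) (h : HasPeriodicPoint m s) :
    HasPeriodicPoint m (-s) := by
  obtain ⟨x, n, k, hn, hx⟩ := h
  have hinv : ∀ y, Gdil m (-s) (Gdil m s y - s) = y - s + ((1 : ℤ) : ℝ) := by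
    intro y
    rw [Gdil_eq_add m (-s), Gdil_eq_add m s, add_sub_cancel_right, Gdil_zero_Gdil_zero hm]
    push_cast
    ring
  have key : ∀ n : ℕ, (Gdil m (-s))^[n] ((Gdil m s)^[n] x - s) = x - s + ((n : ℤ) : ℝ) := by
    intro n
    induction n with
    | zero => simp
    | succ n ih =>
      rw [Function.iterate_succ_apply, Function.iterate_succ_apply', hinv,
        Gdil_iterate_add_intCast, ih]
      push_cast
      ring
  refine ⟨x - s, n, n - k, hn, ?_⟩
  have h := key n
  rw [hx, add_sub_right_comm, Gdil_iterate_add_intCast] at h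
  push_cast at h ⊢
  linarith

theorem HasPeriodicPoint.one_sub {m s : ℝ} (hm : m ∈ Ioo (0 : ℝ) 1) (h : HasPeriodicPoint m s) :
    HasPeriodicPoint (1 - m) s := by
  obtain ⟨x, n, k, hn, hx⟩ := h
  have hm' : 1 - m ∈ Ioo (0 : ℝ) 1 := ⟨by linarith [hm.2], by linarith [hm.1]⟩
  have hsemi : Function.Semiconj (fun x => x - (1 - m)) (Gdil m s) (Gdil (1 - m) s) := by
    intro y
    obtain ⟨u, rfl⟩ := tileCoord_surjective hm y
    show Gdil m s (tileCoord m u) - (1 - m) = Gdil (1 - m) s (tileCoord m u - (1 - m))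
    rw [← tileCoord_one_sub, Gdil_eq_add m s, Gdil_eq_add (1 - m) s, Gdil_zero_tileCoord hm,
      Gdil_zero_tileCoord hm', sub_add_cancel, ← add_sub_cancel_right u 1, tileCoord_one_sub,
      add_sub_cancel_right]
    ring
  refine ⟨x - (1 - m), n, k, hn, ?_⟩
  have h := (hsemi.iterate_right n) x
  simp only [hx] at h
  rw [← h]
  ring

/-- A half-leaf of direction `s` in the universal cover of the dilation torus, written in
coordinates for which the tiles are the unit squares: at height `v ∈ [j, j + 1]` the half-leaf is
at abscissa `ℓ v`, and it crosses the row boundaries along the orbit of `y` under `Gdil m s`. -/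
def IsHalfLeaf (m s y : ℝ) (ℓ : ℝ → ℝ) : Prop :=
  ∀ (j : ℕ) (v : ℝ), (j : ℝ) ≤ v → v ≤ j + 1 →
    tileCoord m (ℓ v + j) = (Gdil m s)^[j] y + s * (v - j - 1)

theorem exists_isHalfLeaf {m : ℝ} (hm : m ∈ Ioo (0 : ℝ) 1) (s y : ℝ) :
    ∃ ℓ, IsHalfLeaf m s y ℓ := by
  choose d hd using tileCoord_surjective hm
  have hinj := (tileCoord_strictMono hm).injective
  refine ⟨fun v => d ((Gdil m s)^[⌊v⌋₊] y + s * (v - ⌊v⌋₊ - 1)) - ⌊v⌋₊, ?_⟩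
  intro j v h0 h1
  have hv : 0 ≤ v := (Nat.cast_nonneg j).trans h0
  rcases h1.lt_or_eq with h | rfl
  · have : ⌊v⌋₊ = j := (Nat.floor_eq_iff hv).2 ⟨h0, h⟩
    simp only [this, sub_add_cancel, hd]
  · have : ⌊(j : ℝ) + 1⌋₊ = j + 1 := by exact_mod_cast Nat.floor_natCast (R := ℝ) (j + 1)
    simp only [this, Function.iterate_succ_apply']
    have hfix : d (Gdil m s ((Gdil m s)^[j] y) + s * ((j : ℝ) + 1 - ((j + 1 : ℕ) : ℝ) - 1))
        = d ((Gdil m s)^[j] y) + 1 := by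
      apply hinj
      rw [hd, ← Gdil_zero_tileCoord hm, hd, Gdil_eq_add m s]
      push_cast
      ring
    rw [hfix]
    push_cast
    rw [show d ((Gdil m s)^[j] y) + 1 - ((j : ℝ) + 1) + j = d ((Gdil m s)^[j] y) by ring, hd]
    ring

namespace IsHalfLeaf

variable {m s y : ℝ} {ℓ : ℝ → ℝ}

theorem tileCoord_sub (hℓ : IsHalfLeaf m s y ℓ) (j : ℕ) {a b : ℝ} (ha : (j : ℝ) ≤ a)
    (hab : a ≤ b) (hb : b ≤ j + 1) :
    tileCoord m (ℓ b + j) - tileCoord m (ℓ a + j) = s * (b - a) := by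
  rw [hℓ j a ha (hab.trans hb), hℓ j b (ha.trans hab) hb]
  ring

theorem lt (hℓ : IsHalfLeaf m s y ℓ) (hm : m ∈ Ioo (0 : ℝ) 1) (hs : 0 < s) {a b : ℝ}
    (ha : 0 ≤ a) (hab : a < b) : ℓ a < ℓ b := by
  refine rel_of_rel_on_unit_intervals (fun x y => ℓ x < ℓ y) (fun _ _ _ => lt_trans) hab ?_
  intro j x z hax hxz _ hj hj'
  have hj0 : 0 ≤ j := by
    have : (-1 : ℝ) < j := by linarith
    have : -1 < j := by exact_mod_cast this
    omega
  lift j to ℕ using hj0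
  push_cast at hj hj'
  have h := hℓ.tileCoord_sub j hj hxz.le hj'
  have := mul_pos hs (sub_pos.2 hxz)
  have := (tileCoord_strictMono hm).lt_iff_lt.1 (sub_pos.1 (h ▸ this))
  show ℓ x < ℓ z
  linarith

theorem le (hℓ : IsHalfLeaf m s y ℓ) (hm : m ∈ Ioo (0 : ℝ) 1) (hs : 0 < s) {a b : ℝ}
    (ha : 0 ≤ a) (hab : a ≤ b) : ℓ a ≤ ℓ b := by
  rcases hab.lt_or_eq with h | rfl
  · exact (hℓ.lt hm hs ha h).le
  · exact le_rfl

theorem eq_of_eq (hℓ : IsHalfLeaf m s y ℓ) (hm : m ∈ Ioo (0 : ℝ) 1) (hs : 0 < s) {a b : ℝ}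
    (ha : 0 ≤ a) (hb : 0 ≤ b) (hab : ℓ a = ℓ b) : a = b := by
  rcases lt_trichotomy a b with h | h | h
  · exact absurd hab (hℓ.lt hm hs ha h).ne
  · exact h
  · exact absurd hab (hℓ.lt hm hs hb h).ne'

theorem add_period (hℓ : IsHalfLeaf m s y ℓ) (hm : m ∈ Ioo (0 : ℝ) 1) {n : ℕ} {k : ℤ}
    (hy : (Gdil m s)^[n] y = y + k) {v : ℝ} (hv : 0 ≤ v) :
    ℓ (v + n) = ℓ v + (2 * k - n : ℤ) := by
  have h0 := Nat.floor_le hv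
  have h1 := (Nat.lt_floor_add_one v).le
  have h2 := hℓ ⌊v⌋₊ v h0 h1
  have h3 := hℓ (⌊v⌋₊ + n) (v + n) (by push_cast; linarith) (by push_cast; linarith)
  rw [Function.iterate_add_apply, hy, Gdil_iterate_add_intCast] at h3
  have h4 := tileCoord_add_two_mul m (ℓ v + ⌊v⌋₊) k
  have h5 : ℓ (v + n) + (⌊v⌋₊ + n : ℕ) = ℓ v + ⌊v⌋₊ + 2 * k := by
    apply (tileCoord_strictMono hm).injective
    rw [h3, h4, h2]
    push_cast
    ring
  push_cast at h5 ⊢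
  linarith

theorem exists_eq (hℓ : IsHalfLeaf m s y ℓ) (hm : m ∈ Ioo (0 : ℝ) 1) (hs : 0 < s) {x : ℝ}
    (hx : ℓ 0 ≤ x) (hx' : ∃ j : ℕ, x ≤ ℓ j) : ∃ v, 0 ≤ v ∧ ℓ v = x := by
  classical
  rcases hx.eq_or_lt with h | hlt
  · exact ⟨0, le_rfl, h⟩
  obtain ⟨j, hj⟩ : ∃ j, Nat.find hx' = j + 1 := by
    refine Nat.exists_eq_succ_of_ne_zero fun h0 => ?_
    have := Nat.find_spec hx'
    rw [h0] at this
    push_cast at this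
    linarith
  have hub : x ≤ ℓ ((j : ℝ) + 1) := by
    have := Nat.find_spec hx'
    rw [hj] at this
    exact_mod_cast this
  have hlb : ℓ j < x := by
    have := Nat.find_min hx' (m := j) (by omega)
    push Not at this
    exact this
  have hmono := (tileCoord_strictMono hm).monotone
  have e0 := hℓ j j le_rfl (by linarith)
  have e1 := hℓ j (j + 1) (by linarith) le_rfl
  have l0 := hmono (add_le_add_left hlb.le (j : ℝ))
  have l1 := hmono (add_le_add_left hub (j : ℝ))
  have hv : ∃ v, s * (v - j - 1) = tileCoord m (x + j) - (Gdil m s)^[j] y :=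
    ⟨(tileCoord m (x + j) - (Gdil m s)^[j] y) / s + j + 1, by field_simp; ring⟩
  obtain ⟨v, hv⟩ := hv
  have hv0 : (j : ℝ) ≤ v := by
    by_contra! hc
    nlinarith
  have hv1 : v ≤ j + 1 := by
    by_contra! hc
    nlinarith
  refine ⟨v, (Nat.cast_nonneg j).trans hv0, ?_⟩
  have := hℓ j v hv0 hv1
  rw [hv, add_sub_cancel] at this
  exact add_right_cancel ((tileCoord_strictMono hm).injective this)

/-- Crossing a column of tiles moves the height by the translation of the transverse section. -/
theorem tileCoord_cross (hℓ : IsHalfLeaf m s y ℓ) (hm : m ∈ Ioo (0 : ℝ) 1) (hs : 0 < s)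
    {a b : ℝ} {i : ℤ} (ha : 0 ≤ a) (hb : 0 ≤ b) (hai : ℓ a = i) (hbi : ℓ b = i + 1) :
    tileCoord (1 - m) (b + i) = tileCoord (1 - m) (a + i) + m * (1 - m) / s := by
  have hab : a < b := by
    by_contra! hc
    linarith [hℓ.le hm hs hb hc]
  have key := rel_of_rel_on_unit_intervals
    (fun x z => tileCoord (1 - m) (z + i) - tileCoord (1 - m) (x + i)
      = m * (1 - m) / s * (ℓ z - ℓ x)) (fun x z w h1 h2 => by linarith) hab ?_
  · rw [hai, hbi] at key
    linarith
  intro j x z hax hxz hzb hj hj'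
  have hx : 0 ≤ x := ha.trans hax
  have hj0 : 0 ≤ j := by
    have : (-1 : ℝ) < j := by linarith
    have : -1 < j := by exact_mod_cast this
    omega
  lift j to ℕ using hj0
  push_cast at hj hj'
  have h1 := hℓ.tileCoord_sub j hj hxz.le hj'
  have lx0 := hℓ.le hm hs ha hax
  have lxz := hℓ.le hm hs hx hxz.le
  have lz1 := hℓ.le hm hs (hx.trans hxz.le) hzb
  have h2 := _root_.tileCoord_sub m (i + j) (u := ℓ x + j) (v := ℓ z + j)
    (by push_cast; linarith) (by push_cast; linarith) (by push_cast; linarith)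
    (by push_cast; linarith)
  have h3 := _root_.tileCoord_sub (1 - m) (i + j) (u := x + i) (v := z + i)
    (by push_cast; linarith) (by push_cast; linarith) (by push_cast; linarith)
    (by push_cast; linarith)
  have h4 := tileWidth_mul_tileWidth m (i + j)
  show tileCoord (1 - m) (z + i) - tileCoord (1 - m) (x + i) = m * (1 - m) / s * (ℓ z - ℓ x)
  rw [h3, ← h4]
  rw [h1] at h2
  have h5 : z - x = tileWidth m (i + j) * (ℓ z - ℓ x) / s := by
    field_simp
    linarith
  rw [show z + (i : ℝ) - (x + i) = z - x by ring, h5]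
  ring

end IsHalfLeaf

/-- Following closed leaves from the horizontal to the vertical section. -/
theorem HasPeriodicPoint.dual_of_pos {m s : ℝ} (hm : m ∈ Ioo (0 : ℝ) 1) (hs : 0 < s)
    (h : HasPeriodicPoint m s) : HasPeriodicPoint (1 - m) (m * (1 - m) / s) := by
  obtain ⟨y, n, k, hn, hy⟩ := h
  have hm' : 1 - m ∈ Ioo (0 : ℝ) 1 := ⟨by linarith [hm.2], by linarith [hm.1]⟩
  obtain ⟨ℓ, hℓ⟩ := exists_isHalfLeaf hm s y
  have hper : ∀ v, 0 ≤ v → ℓ (v + n) = ℓ v + (2 * k - n : ℤ) := fun v => hℓ.add_period hm hy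
  have hn0 : (0 : ℝ) < n := by exact_mod_cast hn
  obtain ⟨N, hN⟩ : ∃ N : ℕ, 2 * k - n = (N : ℤ) ∧ 1 ≤ N := by
    have h1 := hper 0 le_rfl
    have h2 := hℓ.lt hm hs le_rfl (show (0 : ℝ) < 0 + n by linarith)
    have h3 : (0 : ℝ) < (2 * k - n : ℤ) := by linarith
    have h4 : 0 < 2 * k - (n : ℤ) := by exact_mod_cast h3
    exact ⟨(2 * k - n).toNat, by omega, by omega⟩
  obtain ⟨hN, hN1⟩ := hN
  have hunb : ∀ q : ℕ, ℓ ((q * n : ℕ) : ℝ) = ℓ 0 + q * N := by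
    intro q
    induction q with
    | zero => simp
    | succ q ih =>
      have := hper ((q * n : ℕ) : ℝ) (Nat.cast_nonneg _)
      rw [ih, hN] at this
      rw [Nat.succ_mul, Nat.cast_add, this]
      push_cast
      ring
  have hex : ∀ i : ℕ, ∃ v, 0 ≤ v ∧ ℓ v = ((⌈ℓ 0⌉ + i : ℤ) : ℝ) := by
    intro i
    refine hℓ.exists_eq hm hs ?_ ?_
    · push_cast
      have := Int.le_ceil (ℓ 0)
      have : (0 : ℝ) ≤ i := Nat.cast_nonneg i
      linarith
    · refine ⟨(i + 1) * n, ?_⟩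
      rw [hunb]
      have h1 := Int.ceil_lt_add_one (ℓ 0)
      have h2 : (1 : ℝ) ≤ N := by exact_mod_cast hN1
      have h3 : (0 : ℝ) ≤ i := Nat.cast_nonneg i
      push_cast
      nlinarith
  choose v hv0 hv using hex
  have horbit : ∀ i : ℕ,
      (Gdil (1 - m) (m * (1 - m) / s))^[i] (tileCoord (1 - m) (v 0 + ⌈ℓ 0⌉) + m * (1 - m) / s)
        = tileCoord (1 - m) (v i + (⌈ℓ 0⌉ + i : ℤ)) + m * (1 - m) / s := by
    intro i
    induction i with
    | zero => simp
    | succ i ih =>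
      have hc := hℓ.tileCoord_cross hm hs (hv0 i) (hv0 (i + 1)) (hv i)
        (by rw [hv]; push_cast; ring)
      rw [Function.iterate_succ_apply', ih, ← hc, Gdil_eq_add, Gdil_zero_tileCoord hm']
      push_cast
      ring_nf
  have hvN : v N = v 0 + n := by
    refine hℓ.eq_of_eq hm hs (hv0 N) (by linarith [hv0 0]) ?_
    rw [hv, hper _ (hv0 0), hv, hN]
    push_cast
    ring
  refine ⟨_, N, k, hN1, (horbit N).trans ?_⟩
  have hk : (N : ℝ) = 2 * k - n := by
    have : ((2 * k - n : ℤ) : ℝ) = ((N : ℤ) : ℝ) := by rw [hN]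
    push_cast at this
    linarith
  have h2 := tileCoord_add_two_mul (1 - m) (v 0 + ⌈ℓ 0⌉) k
  rw [hvN]
  push_cast
  rw [hk, show v 0 + n + (⌈ℓ 0⌉ + (2 * k - n)) = v 0 + ⌈ℓ 0⌉ + 2 * (k : ℝ) by ring, h2]
  ring

theorem HasPeriodicPoint.dual {m s : ℝ} (hm : m ∈ Ioo (0 : ℝ) 1) (hs : s ≠ 0)
    (h : HasPeriodicPoint m s) : HasPeriodicPoint m (m * (1 - m) / s) := by
  have hm' : 1 - m ∈ Ioo (0 : ℝ) 1 := ⟨by linarith [hm.2], by linarith [hm.1]⟩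
  rcases hs.lt_or_gt with hneg | hpos
  · have h1 := (((h.neg hm).dual_of_pos hm (neg_pos.2 hneg)).one_sub hm').neg (by simpa using hm)
    simpa [div_neg] using h1
  · simpa using (h.dual_of_pos hm hpos).one_sub hm'

/-- The direction of a vector, as a point of the projective line, has a closed leaf. The horizontal
direction always has one. -/
def HasClosedLeaf (m : ℝ) (w : Fin 2 → ℝ) : Prop := w 1 = 0 ∨ HasPeriodicPoint m (w 0 / w 1)

theorem HasClosedLeaf.dual {m : ℝ} (hm : m ∈ Ioo (0 : ℝ) 1) {w : Fin 2 → ℝ}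
    (h : HasClosedLeaf m w) : HasClosedLeaf m ![m * (1 - m) * w 1, w 0] := by
  unfold HasClosedLeaf at *
  simp only [Matrix.cons_val_zero, Matrix.cons_val_one]
  by_cases h0 : w 0 = 0
  · exact Or.inl h0
  by_cases h1 : w 1 = 0
  · right
    simpa [h1] using hasPeriodicPoint_zero hm
  · right
    have := (h.resolve_left h1).dual hm (div_ne_zero h0 h1)
    rwa [div_div_eq_mul_div] at this

theorem hasClosedLeaf_smul_iff {m c : ℝ} (hc : c ≠ 0) {w : Fin 2 → ℝ} :
    HasClosedLeaf m (c • w) ↔ HasClosedLeaf m w := by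
  simp [HasClosedLeaf, hc, mul_div_mul_left]

theorem hasClosedLeaf_dual_iff {m : ℝ} (hm : m ∈ Ioo (0 : ℝ) 1) {w : Fin 2 → ℝ} :
    HasClosedLeaf m ![m * (1 - m) * w 1, w 0] ↔ HasClosedLeaf m w := by
  refine ⟨fun h => ?_, fun h => h.dual hm⟩
  have hc : m * (1 - m) ≠ 0 := mul_ne_zero hm.1.ne' (sub_pos.2 hm.2).ne'
  refine (hasClosedLeaf_smul_iff hc).1 ?_
  convert h.dual hm using 1
  ext i
  fin_cases i <;> simp

theorem hasClosedLeaf_shear_iff {m : ℝ} {w : Fin 2 → ℝ} :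
    HasClosedLeaf m (!![1, 1; 0, 1] *ᵥ w) ↔ HasClosedLeaf m w := by
  have e : !![1, 1; 0, 1] *ᵥ w = ![w 0 + w 1, w 1] := by
    ext i
    fin_cases i <;> simp [Matrix.mulVec, dotProduct, Fin.sum_univ_two]
  rw [e]
  unfold HasClosedLeaf
  simp only [Matrix.cons_val_zero, Matrix.cons_val_one]
  by_cases h : w 1 = 0
  · simp [h]
  · rw [add_div, div_self h, hasPeriodicPoint_add_one_iff]

theorem hasClosedLeaf_transvection_iff {m : ℝ} (hm : m ∈ Ioo (0 : ℝ) 1) {w : Fin 2 → ℝ} :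
    HasClosedLeaf m (!![1, 0; 1 / (m - m ^ 2), 1] *ᵥ w) ↔ HasClosedLeaf m w := by
  have h0 : m ≠ 0 := hm.1.ne'
  have h1 : 1 - m ≠ 0 := (sub_pos.2 hm.2).ne'
  have h2 : m - m ^ 2 = m * (1 - m) := by ring
  rw [← hasClosedLeaf_dual_iff hm, ← hasClosedLeaf_dual_iff hm (w := w),
    ← hasClosedLeaf_shear_iff (w := ![m * (1 - m) * w 1, w 0]), h2]
  refine iff_of_eq (congrArg _ ?_)
  ext i
  fin_cases i
  · simp [Matrix.mulVec, dotProduct, Fin.sum_univ_two]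
    field_simp
    ring
  · simp [Matrix.mulVec, dotProduct, Fin.sum_univ_two]

theorem hasClosedLeaf_inv_mulVec_iff {m : ℝ} {N : Matrix (Fin 2) (Fin 2) ℝ}
    (hN : IsUnit N.det) (h : ∀ w, HasClosedLeaf m (N *ᵥ w) ↔ HasClosedLeaf m w)
    (w : Fin 2 → ℝ) : HasClosedLeaf m (N⁻¹ *ᵥ w) ↔ HasClosedLeaf m w := by
  rw [← h (N⁻¹ *ᵥ w), Matrix.mulVec_mulVec, Matrix.mul_nonsing_inv N hN, Matrix.one_mulVec]

/-- the Veech-group action on the direction parameter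
preserves existence of periodic points: if M is a finite product of the
generators A, B and their inverses, and s' = M·s is the Möbius image of s,
then g_{m,s} has a periodic point iff g_{m,s'} has one. -/
theorem stmt13 (m : ℝ) (hm : m ∈ Set.Ico (1 / 2 : ℝ) 1)
    (M : Matrix (Fin 2) (Fin 2) ℝ)
    (hM : ∃ L : List (Matrix (Fin 2) (Fin 2) ℝ),
      (∀ N ∈ L, N = !![1, 1; 0, 1] ∨ N = (!![1, 1; 0, 1])⁻¹ ∨
        N = !![1, 0; 1 / (m - m ^ 2), 1] ∨
        N = (!![1, 0; 1 / (m - m ^ 2), 1])⁻¹) ∧ M = L.prod)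
    (s : ℝ) (hden : M 1 0 * s + M 1 1 ≠ 0) :
    (∃ (x : ℝ) (n : ℕ) (k : ℤ), 1 ≤ n ∧ (Gdil m s)^[n] x = x + (k : ℝ)) ↔
    (∃ (x : ℝ) (n : ℕ) (k : ℤ), 1 ≤ n ∧
      (Gdil m ((M 0 0 * s + M 0 1) / (M 1 0 * s + M 1 1)))^[n] x = x + (k : ℝ)) := by
  have hm0 : m ∈ Ioo (0 : ℝ) 1 := ⟨by linarith [hm.1], hm.2⟩
  obtain ⟨L, hL, rfl⟩ := hM
  have key : ∀ w : Fin 2 → ℝ, HasClosedLeaf m (L.prod.mulVec w) ↔ HasClosedLeaf m w := by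
    clear hden
    induction L with
    | nil => simp
    | cons N L ih =>
      intro w
      rw [List.prod_cons, ← Matrix.mulVec_mulVec]
      refine Iff.trans ?_ (ih (fun N' h => hL N' (List.mem_cons_of_mem _ h)) w)
      rcases hL N List.mem_cons_self with rfl | rfl | rfl | rfl
      · exact hasClosedLeaf_shear_iff
      · exact hasClosedLeaf_inv_mulVec_iff (by simp [Matrix.det_fin_two])
          (fun _ => hasClosedLeaf_shear_iff) _
      · exact hasClosedLeaf_transvection_iff hm0
      · exact hasClosedLeaf_inv_mulVec_iff (by simp [Matrix.det_fin_two])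
          (fun _ => hasClosedLeaf_transvection_iff hm0) _
  have h := key ![s, 1]
  simp only [HasClosedLeaf, Matrix.mulVec, dotProduct, Fin.sum_univ_two, Matrix.cons_val_zero,
    Matrix.cons_val_one, mul_one, div_one, one_ne_zero, false_or, hden] at h
  exact h.symm
end
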